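/- arXiv:1511.04719 — 5 statements merged into one kernel-verified Lean document; each statement's English description precedes it below -/
import Mathlib

section
/- Let h ∈ ℂ[x₀,x₁,x₂,y₀,y₁,y₂] be an irreducible bihomogeneous polynomial with positive degree in the x-variables and positive degree in the y-variables. Then there is a nonempty Zariski-open subset U ⊆ ℙ² such that for every u ∈ U (with any chosen representative vector of u), the polynomial h(u, y₀,y₁,y₂) ∈ ℂ[y₀,y₁,y₂] is nonzero and squarefree, i.e. it is not divisible by the square of any nonconstant polynomial. -/
open MvPolynomial

noncomputable section

/-- Points of `ℙⁿ⁻¹` over `ℂ`: nonzero vectors of `ℂⁿ` up to scalar. -/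
abbrev Pt (n : ℕ) := Projectivization ℂ (Fin n → ℂ)

/-- Weight function selecting the `x`-variables. -/
def wx (n : ℕ) : Fin n ⊕ Fin n → ℕ := Sum.elim (fun _ => 1) (fun _ => 0)

/-- Weight function selecting the `y`-variables. -/
def wy (n : ℕ) : Fin n ⊕ Fin n → ℕ := Sum.elim (fun _ => 0) (fun _ => 1)

/-- A polynomial in the variables `x₀,…,x_{n-1},y₀,…,y_{n-1}` is bihomogeneous if it is
homogeneous in the `x`-variables and homogeneous in the `y`-variables. -/
def Bihom {n : ℕ} (F : MvPolynomial (Fin n ⊕ Fin n) ℂ) : Prop :=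
  ∃ a b, F.IsWeightedHomogeneous (wx n) a ∧ F.IsWeightedHomogeneous (wy n) b

/-- The degree of `F` in the `x`-variables. -/
def xdeg {n : ℕ} (F : MvPolynomial (Fin n ⊕ Fin n) ℂ) : ℕ :=
  MvPolynomial.weightedTotalDegree (wx n) F

/-- The degree of `F` in the `y`-variables. -/
def ydeg {n : ℕ} (F : MvPolynomial (Fin n ⊕ Fin n) ℂ) : ℕ :=
  MvPolynomial.weightedTotalDegree (wy n) F

/-- The zero set in `ℙⁿ⁻¹ × ℙⁿ⁻¹` of a bihomogeneous polynomial. -/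
def zeroSet {n : ℕ} (F : MvPolynomial (Fin n ⊕ Fin n) ℂ) : Set (Pt n × Pt n) :=
  {p | eval (Sum.elim p.1.rep p.2.rep) F = 0}

/-- A Zariski-open subset of `ℙⁿ⁻¹`: the complement of the common zero set of a finite
family of homogeneous polynomials. -/
def ZarOpen {n : ℕ} (X : Set (Pt n)) : Prop :=
  ∃ S : Finset (MvPolynomial (Fin n) ℂ),
    (∀ g ∈ S, ∃ d, g.IsHomogeneous d) ∧
    X = {p : Pt n | ¬ ∀ g ∈ S, eval p.rep g = 0}

/-- `V ⊆ P₁ × P₂` is `(s,t)`-grid-free if there are no `S ⊆ P₁`, `T ⊆ P₂` with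
`|S| = s`, `|T| = t` and `S × T ⊆ V`. -/
def GridFree {α β : Type*} (s t : ℕ) (V : Set (α × β)) : Prop :=
  ¬ ∃ (S : Finset α) (T : Finset β), S.card = s ∧ T.card = t ∧
      ∀ a ∈ S, ∀ b ∈ T, (a, b) ∈ V

/-- Substituting the vector `u` for the `x`-variables of a polynomial in
`x₀,…,x_{n-1},y₀,…,y_{n-1}` yields a polynomial in the `y`-variables. -/
def sectionPoly {n : ℕ} (F : MvPolynomial (Fin n ⊕ Fin n) ℂ) (u : Fin n → ℂ) :
    MvPolynomial (Fin n) ℂ :=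
  aeval (Sum.elim (fun i => MvPolynomial.C (u i)) MvPolynomial.X) F

/-- Over a factorial domain of characteristic zero, the ideal generated by an irreducible
polynomial and its derivative contains a nonzero constant. -/
theorem exists_mul_add_mul_derivative_eq_C {A : Type*} [CommRing A] [IsDomain A]
    [UniqueFactorizationMonoid A] [CharZero A] {f : Polynomial A} (hf : Irreducible f) :
    ∃ d : A, d ≠ 0 ∧ ∃ a b, a * f + b * Polynomial.derivative f = Polynomial.C d := by
  by_cases h0 : f.natDegree = 0
  · obtain ⟨c, rfl⟩ := Polynomial.natDegree_eq_zero.1 h0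
    exact ⟨c, fun hc => hf.ne_zero (by simp [hc]), 1, 0, by simp⟩
  let _ : NormalizedGCDMonoid A := Nonempty.some inferInstance
  let K := FractionRing A
  have : CharZero K := IsFractionRing.charZero A
  obtain ⟨a, b, hab⟩ := (((hf.isPrimitive h0).irreducible_iff_irreducible_map_fraction_map
    (K := K)).1 hf).separable
  obtain ⟨r, hr, ha⟩ := IsLocalization.integerNormalization_spec (nonZeroDivisors A) a
  obtain ⟨s, hs, hb⟩ := IsLocalization.integerNormalization_spec (nonZeroDivisors A) b
  refine ⟨r * s, mul_ne_zero (nonZeroDivisors.ne_zero hr) (nonZeroDivisors.ne_zero hs),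
    Polynomial.C s * IsLocalization.integerNormalization (nonZeroDivisors A) a,
    Polynomial.C r * IsLocalization.integerNormalization (nonZeroDivisors A) b,
    Polynomial.map_injective (algebraMap A K) (IsFractionRing.injective A K) ?_⟩
  rw [Polynomial.derivative_map] at hab
  simp only [Polynomial.map_add, Polynomial.map_mul, ha, hb, Polynomial.map_C, map_mul,
    Algebra.smul_def, Polynomial.algebraMap_apply]
  linear_combination (Polynomial.C (algebraMap A K r) * Polynomial.C (algebraMap A K s)) * hab

namespace MvPolynomial

variable {σ R : Type*} [CommRing R]

/-- A multivariate polynomial, viewed as a polynomial in the variable `i`. -/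
def singleOut [DecidableEq σ] (i : σ) :
    MvPolynomial σ R ≃ₐ[R] Polynomial (MvPolynomial {j // j ≠ i} R) :=
  (renameEquiv R (Equiv.optionSubtypeNe i).symm).trans (optionEquivLeft R _)

theorem natDegree_singleOut [DecidableEq σ] (i : σ) (p : MvPolynomial σ R) :
    (singleOut i p).natDegree = degreeOf i p :=
  (degreeOf_eq_natDegree i p).symm

theorem singleOut_pderiv [DecidableEq σ] (i : σ) (p : MvPolynomial σ R) :
    singleOut i (pderiv i p) = Polynomial.derivative (singleOut i p) := by
  induction p using MvPolynomial.induction_on with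
  | C a => simp [singleOut]
  | add p q hp hq => simp [hp, hq]
  | mul_X p j hp =>
    have hX : singleOut (R := R) i (pderiv i (X j)) =
        Polynomial.derivative (singleOut i (X j)) := by
      by_cases hj : j = i
      · subst hj
        simp [singleOut]
      · simp [singleOut, pderiv_X_of_ne hj, Equiv.optionSubtypeNe_symm_of_ne hj]
    rw [pderiv_mul, map_add, map_mul, map_mul, hp, hX, map_mul, Polynomial.derivative_mul]

theorem pderiv_eq_zero_iff [IsDomain R] [CharZero R] (i : σ) (p : MvPolynomial σ R) :
    pderiv i p = 0 ↔ degreeOf i p = 0 := by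
  classical
  rw [← natDegree_singleOut, ← Polynomial.derivative_eq_zero, ← singleOut_pderiv,
    EmbeddingLike.map_eq_zero_iff (f := singleOut i)]

theorem degreeOf_eq_zero_of_dvd [IsDomain R] {i : σ} {p q : MvPolynomial σ R}
    (hpq : p ∣ q) (hq : q ≠ 0) (hd : degreeOf i q = 0) : degreeOf i p = 0 := by
  obtain ⟨r, rfl⟩ := hpq
  rw [degreeOf_mul_eq (left_ne_zero_of_mul hq) (right_ne_zero_of_mul hq)] at hd
  omega

theorem totalDegree_eq_zero_of_degreeOf {p : MvPolynomial σ R}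
    (hp : ∀ i, degreeOf i p = 0) : p.totalDegree = 0 := by
  rw [totalDegree_eq_zero_iff]
  exact fun m hm i => Nat.le_zero.1 (hp i ▸ monomial_le_degreeOf i hm)

/-- The variable `i` can be eliminated from an irreducible polynomial and its partial
derivative with respect to `i`. -/
theorem exists_ne_zero_pderiv_eq_zero {K : Type*} [Field K] [CharZero K]
    {p : MvPolynomial σ K} (hp : Irreducible p) (i : σ) :
    ∃ E : MvPolynomial σ K, E ≠ 0 ∧ pderiv i E = 0 ∧ ∃ a b, E = a * p + b * pderiv i p := by
  classical
  obtain ⟨d, hd, a, b, h⟩ := exists_mul_add_mul_derivative_eq_C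
    ((MulEquiv.irreducible_iff (singleOut (R := K) i)).2 hp)
  refine ⟨(singleOut i).symm (Polynomial.C d), by simpa using hd, ?_,
    (singleOut i).symm a, (singleOut i).symm b, ?_⟩
  · apply (singleOut i).injective
    simp [singleOut_pderiv]
  · apply (singleOut i).injective
    simp [singleOut_pderiv, h]

theorem IsWeightedHomogeneous.aeval_pow_smul {S : Type*} [CommRing S] [Algebra R S]
    {w : σ → ℕ} {a : ℕ} {F : MvPolynomial σ R} (hF : F.IsWeightedHomogeneous w a)
    (t : R) (f : σ → S) : aeval (fun i => t ^ w i • f i) F = t ^ a • aeval f F := by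
  induction hF using IsWeightedHomogeneous.induction_on with
  | zero => simp
  | add p q _ _ hp hq => simp [hp, hq]
  | monomial d r hd =>
    rw [aeval_monomial, aeval_monomial, ← hd, Finsupp.weight_apply, ← mul_smul_comm]
    congr 1
    simp only [Finsupp.prod, Finsupp.sum, ← Finset.prod_pow_eq_pow_sum, smul_pow, ← pow_mul,
      smul_eq_mul, Finset.prod_smul, mul_comm]

theorem IsHomogeneous.eval_smul {d : ℕ} {F : MvPolynomial σ R} (hF : F.IsHomogeneous d)
    (t : R) (v : σ → R) : eval (t • v) F = t ^ d * eval v F := by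
  have := IsWeightedHomogeneous.aeval_pow_smul hF t v
  simp only [Pi.one_apply, pow_one, aeval_eq_eval, smul_eq_mul] at this
  exact this

/-- A polynomial one of whose homogeneous components does not vanish at `v` does not vanish
identically on the punctured line spanned by `v`. -/
theorem exists_eval_smul_ne_zero [IsDomain R] [Infinite R] {g : MvPolynomial σ R} {d : ℕ}
    {v : σ → R} (hd : eval v (homogeneousComponent d g) ≠ 0) :
    ∃ t : R, t ≠ 0 ∧ eval (t • v) g ≠ 0 := by
  let P : Polynomial R := ∑ k ∈ Finset.range (g.totalDegree + 1),
    Polynomial.monomial k (eval v (homogeneousComponent k g))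
  have hP : ∀ t, P.eval t = eval (t • v) g := fun t => by
    conv_rhs => rw [← sum_homogeneousComponent g]
    simp [P, Polynomial.eval_finsetSum, (homogeneousComponent_isHomogeneous _ g).eval_smul,
      mul_comm]
  have hP0 : P ≠ 0 := fun h0 => by
    have hlt : d < g.totalDegree + 1 := by
      by_contra hlt
      exact hd (by rw [homogeneousComponent_eq_zero _ _ (by omega), map_zero])
    have := congrArg (Polynomial.coeff · d) h0
    simp only [P, Polynomial.finsetSum_coeff, Polynomial.coeff_monomial, Polynomial.coeff_zero,
      Finset.sum_ite_eq', Finset.mem_range, if_pos hlt] at this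
    exact hd this
  by_contra! hcon
  refine mul_ne_zero Polynomial.X_ne_zero hP0 (Polynomial.funext fun t => ?_)
  by_cases ht : t = 0
  · simp [ht]
  · simp [hP, hcon t ht]

end MvPolynomial

theorem sectionPoly_smul {n a : ℕ} {F : MvPolynomial (Fin n ⊕ Fin n) ℂ}
    (hF : F.IsWeightedHomogeneous (wx n) a) (t : ℂ) (u : Fin n → ℂ) :
    sectionPoly F (t • u) = C (t ^ a) * sectionPoly F u := by
  rw [← smul_eq_C_mul, sectionPoly, sectionPoly, ← hF.aeval_pow_smul t]
  congr 2
  ext1 (i | i) <;> simp [wx, smul_eq_C_mul]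

theorem pderiv_sectionPoly {n : ℕ} (F : MvPolynomial (Fin n ⊕ Fin n) ℂ) (u : Fin n → ℂ)
    (j : Fin n) :
    pderiv j (sectionPoly F u) = sectionPoly (pderiv (Sum.inr j) F) u := by
  simp only [sectionPoly, aeval_eq_bind₁]
  induction F using MvPolynomial.induction_on with
  | C a => simp
  | add p q hp hq => simp [hp, hq]
  | mul_X p k hp =>
    rcases k with k | k
    · simp [hp]
    · simp [hp, pderiv_X, Pi.single_apply, apply_ite]

/-- A polynomial in `ℂ[x, y]` whose nonvanishing after substituting `u` for the `x`-variables
forces `h(u, ·)` to be nonzero and squarefree. -/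
theorem exists_ne_zero_forall_section_squarefree {n : ℕ} {h : MvPolynomial (Fin n ⊕ Fin n) ℂ}
    (hirr : Irreducible h) :
    ∃ E : MvPolynomial (Fin n ⊕ Fin n) ℂ, E ≠ 0 ∧ ∀ u, sectionPoly E u ≠ 0 →
      sectionPoly h u ≠ 0 ∧ ∀ c : MvPolynomial (Fin n) ℂ, c.totalDegree ≠ 0 →
        ¬ (c ^ 2 ∣ sectionPoly h u) := by
  choose E hE0 hE a b hab using fun j : Fin n => exists_ne_zero_pderiv_eq_zero hirr (Sum.inr j)
  refine ⟨h * ∏ j, E j, mul_ne_zero hirr.ne_zero (Finset.prod_ne_zero_iff.2 fun j _ => hE0 j),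
    fun u hu => ?_⟩
  have hmul : sectionPoly h u * ∏ j, sectionPoly (E j) u ≠ 0 := by
    simpa [sectionPoly] using hu
  refine ⟨left_ne_zero_of_mul hmul, fun c hc ⟨q, hq⟩ => hc (totalDegree_eq_zero_of_degreeOf
    fun j => degreeOf_eq_zero_of_dvd (q := sectionPoly (E j) u) ?_ ?_ ?_)⟩
  · have hd : c ∣ pderiv j (sectionPoly h u) := by
      rw [hq, pow_two, pderiv_mul, pderiv_mul]
      exact ⟨pderiv j c * q + pderiv j c * q + c * pderiv j q, by ring⟩
    have hs : sectionPoly (E j) u = sectionPoly (a j) u * sectionPoly h u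
        + sectionPoly (b j) u * pderiv j (sectionPoly h u) := by
      rw [pderiv_sectionPoly, hab j]
      simp [sectionPoly]
    rw [hs]
    exact dvd_add (Dvd.dvd.mul_left ⟨c * q, by rw [hq]; ring⟩ _) (hd.mul_left _)
  · exact Finset.prod_ne_zero_iff.1 (right_ne_zero_of_mul hmul) j (Finset.mem_univ j)
  · rw [← pderiv_eq_zero_iff, pderiv_sectionPoly, hE]
    simp [sectionPoly]

/-- Substituting a suitable vector for the `y`-variables detects nonvanishing sections. -/
theorem exists_ne_zero_forall_sectionPoly_ne_zero {n : ℕ}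
    {E : MvPolynomial (Fin n ⊕ Fin n) ℂ} (hE : E ≠ 0) :
    ∃ g : MvPolynomial (Fin n) ℂ, g ≠ 0 ∧ ∀ u, eval u g ≠ 0 → sectionPoly E u ≠ 0 := by
  obtain ⟨z, hz⟩ : ∃ z, eval z E ≠ 0 := by
    by_contra! hcon
    exact hE (MvPolynomial.funext fun z => by simp [hcon z])
  let g : MvPolynomial (Fin n) ℂ := aeval (Sum.elim X (fun i => C (z (Sum.inr i)))) E
  have hg : ∀ u, eval u g = eval (fun i => z (Sum.inr i)) (sectionPoly E u) := fun u => by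
    simp only [g, sectionPoly, ← coe_aeval_eq_eval, RingHom.coe_coe, ← AlgHom.comp_apply]
    congr 1
    ext (i | i) <;> simp
  refine ⟨g, fun h0 => hz ?_, fun u hu h0 => hu (by rw [hg, h0, map_zero])⟩
  have : eval (fun i => z (Sum.inl i)) g = eval z E := by
    simp only [g, ← coe_aeval_eq_eval, RingHom.coe_coe, ← AlgHom.comp_apply]
    congr 1
    ext (i | i) <;> simp
  rw [← this, h0, map_zero]

/-- second part of Lemma 4.4 of the paper.  If `h` is an irreducible
bihomogeneous polynomial in `x₀,x₁,x₂,y₀,y₁,y₂` of positive degree in the `x`-variables and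
in the `y`-variables, then for `u` in a nonempty Zariski-open subset of `ℙ²` (and any
representative of `u`) the substituted polynomial `h(u,·) ∈ ℂ[y₀,y₁,y₂]` is nonzero and
squarefree. -/
theorem stmt6
    (h : MvPolynomial (Fin 3 ⊕ Fin 3) ℂ)
    (hirr : Irreducible h) (hbh : Bihom h)
    (hx : 0 < xdeg h) (hy : 0 < ydeg h) :
    ∃ U : Set (Pt 3), ZarOpen U ∧ U.Nonempty ∧
      ∀ u ∈ U, ∀ (w : Fin 3 → ℂ) (hw : w ≠ 0), Projectivization.mk ℂ w hw = u →
        sectionPoly h w ≠ 0 ∧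
          ∀ c : MvPolynomial (Fin 3) ℂ, c.totalDegree ≠ 0 →
            ¬ (c ^ 2 ∣ sectionPoly h w) := by
  obtain ⟨a, -, hxa, -⟩ := hbh
  obtain ⟨E, hE, hsq⟩ := exists_ne_zero_forall_section_squarefree hirr
  obtain ⟨g, hg, hgE⟩ := exists_ne_zero_forall_sectionPoly_ne_zero hE
  obtain ⟨d, hd⟩ : ∃ d, homogeneousComponent d g ≠ 0 := by
    by_contra! hcon
    exact hg (by rw [← sum_homogeneousComponent g, Finset.sum_eq_zero fun k _ => hcon k])
  have hhom := homogeneousComponent_isHomogeneous d g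
  refine ⟨{p | eval p.rep (homogeneousComponent d g) ≠ 0}, ⟨{homogeneousComponent d g}, ?_, ?_⟩,
    ?_, ?_⟩
  · simpa using ⟨d, hhom⟩
  · simp
  · obtain ⟨v, hv⟩ : ∃ v, eval v (X 0 * homogeneousComponent d g) ≠ 0 := by
      by_contra! hcon
      exact mul_ne_zero (X_ne_zero 0) hd (MvPolynomial.funext fun z => by
        rw [hcon z, map_zero])
    rw [map_mul, eval_X] at hv
    have hv0 : v ≠ 0 := fun h0 => left_ne_zero_of_mul hv (by simp [h0])
    refine ⟨Projectivization.mk ℂ v hv0, fun h0 => right_ne_zero_of_mul hv ?_⟩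
    obtain ⟨s, hs⟩ := (Projectivization.mk_eq_mk_iff' ℂ v _ hv0
      (Projectivization.rep_nonzero _)).1
        (Projectivization.mk_rep (Projectivization.mk ℂ v hv0)).symm
    rw [← hs, hhom.eval_smul, h0, mul_zero]
  · rintro u hu w hw rfl
    obtain ⟨t, ht, hgt⟩ := exists_eval_smul_ne_zero hu
    obtain ⟨s, hs⟩ := (Projectivization.mk_eq_mk_iff' ℂ _ w
      (Projectivization.rep_nonzero _) hw).1 (Projectivization.mk_rep (Projectivization.mk ℂ w hw))
    have hs0 : s ≠ 0 := fun h0 => Projectivization.rep_nonzero _ (by rw [← hs, h0, zero_smul])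
    obtain ⟨hne, hsf⟩ := hsq _ (hgE _ hgt)
    rw [← hs, smul_smul, sectionPoly_smul hxa] at hne hsf
    refine ⟨right_ne_zero_of_mul hne, fun c hc hdvd => hsf c hc (hdvd.mul_left _)⟩
end
end

section
/- Let F ∈ ℂ[x₀,x₁,x₂,y₀,y₁,y₂] be a nonzero bihomogeneous polynomial, let H = {F = 0} ⊆ ℙ² × ℙ², let X be a nonempty Zariski-open subset of ℙ², and let Y = ℙ² \ {v₁, v₂, …, v_n} for finitely many points v₁, …, v_n ∈ ℙ². If H ∩ (X × Y) is (2,2)-grid-free, then either (1) there exists a bihomogeneous polynomial F' ∈ ℂ[x₀,x₁,x₂,y₀,y₁,y₂] whose degree in the y-variables is at most 2 such that H ∩ (X × Y) = {F' = 0} ∩ (X × Y), or (2) there exists an index i ∈ {1,…,n} such that ℙ² × {vᵢ} ⊆ H. -/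
open MvPolynomial

noncomputable section

/-- Over a unique factorization domain, two polynomials either generate an ideal containing a
nonzero constant or share an irreducible factor of positive degree. -/
theorem Polynomial.exists_mul_add_mul_eq_C_or_irreducible_dvd {R : Type*} [CommRing R] [IsDomain R]
    [UniqueFactorizationMonoid R] {P : Polynomial R} (Q : Polynomial R) (hP : P ≠ 0) :
    (∃ ρ : R, ρ ≠ 0 ∧ ∃ A B : Polynomial R, A * P + B * Q = Polynomial.C ρ) ∨
      ∃ D : Polynomial R, Irreducible D ∧ 0 < D.natDegree ∧ D ∣ P ∧ D ∣ Q := by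
  classical
  let K := FractionRing R
  have hinj : Function.Injective (algebraMap R K) := IsFractionRing.injective R K
  let _ : NormalizedGCDMonoid R := Classical.choice inferInstance
  set φ := algebraMap R K
  by_cases h : IsCoprime (P.map φ) (Q.map φ)
  · left
    obtain ⟨a, b, hab⟩ := h
    obtain ⟨c, hc, hca⟩ := IsLocalization.integerNormalization_spec (nonZeroDivisors R) a
    obtain ⟨d, hd, hdb⟩ := IsLocalization.integerNormalization_spec (nonZeroDivisors R) b
    rw [Algebra.smul_def, Polynomial.algebraMap_apply] at hca hdb
    refine ⟨c * d, mul_ne_zero (nonZeroDivisors.ne_zero hc) (nonZeroDivisors.ne_zero hd),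
      Polynomial.C d * IsLocalization.integerNormalization (nonZeroDivisors R) a,
      Polynomial.C c * IsLocalization.integerNormalization (nonZeroDivisors R) b, ?_⟩
    apply Polynomial.map_injective φ hinj
    simp only [Polynomial.map_add, Polynomial.map_mul, Polynomial.map_C]
    rw [hca, hdb]
    simp only [map_mul]
    linear_combination Polynomial.C (φ c) * Polynomial.C (φ d) * hab
  · right
    have hP' : P.map φ ≠ 0 := (Polynomial.map_ne_zero_iff hinj).2 hP
    rw [← EuclideanDomain.gcd_isUnit_iff] at h
    obtain ⟨f, hf, hfd⟩ := WfDvdMonoid.exists_irreducible_factor h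
      (fun h0 => hP' (EuclideanDomain.gcd_eq_zero_iff.1 h0).1)
    obtain ⟨c, hc, hcf⟩ := IsLocalization.integerNormalization_spec (nonZeroDivisors R) f
    set F := IsLocalization.integerNormalization (nonZeroDivisors R) f
    have hF : F ≠ 0 := by
      rw [Ne, IsFractionRing.integerNormalization_eq_zero_iff]; exact hf.ne_zero
    rw [Algebra.smul_def, Polynomial.algebraMap_apply, F.eq_C_content_mul_primPart,
      Polynomial.map_mul, Polynomial.map_C] at hcf
    have hu : ∀ r : R, r ≠ 0 → IsUnit (Polynomial.C (φ r)) := fun r hr =>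
      Polynomial.isUnit_C.2 (isUnit_iff_ne_zero.2 ((map_ne_zero_iff φ hinj).2 hr))
    have hass : Associated (F.primPart.map φ) f := by
      have h1 : Associated (Polynomial.C (φ F.content) * F.primPart.map φ) (F.primPart.map φ) :=
        associated_unit_mul_left _ _ (hu _ (mt Polynomial.content_eq_zero_iff.1 hF))
      have h2 : Associated (Polynomial.C (φ c) * f) f :=
        associated_unit_mul_left _ _ (hu _ (nonZeroDivisors.ne_zero hc))
      rw [hcf] at h1
      exact h1.symm.trans h2
    have hirr : Irreducible F.primPart :=
      (F.isPrimitive_primPart.irreducible_iff_irreducible_map_fraction_map (K := K)).2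
        (hass.symm.irreducible hf)
    refine ⟨F.primPart, hirr, ?_, ?_, ?_⟩
    · have h1 := (hass.symm.irreducible hf).natDegree_pos
      rwa [Polynomial.natDegree_map_eq_of_injective hinj] at h1
    · exact F.isPrimitive_primPart.dvd_of_fraction_map_dvd_fraction_map (K := K)
        (hass.dvd.trans (hfd.trans (EuclideanDomain.gcd_dvd_left _ _)))
    · exact F.isPrimitive_primPart.dvd_of_fraction_map_dvd_fraction_map (K := K)
        (hass.dvd.trans (hfd.trans (EuclideanDomain.gcd_dvd_right _ _)))

theorem Polynomial.exists_mul_add_derivative_eq_C_or_sq_dvd {R : Type*} [CommRing R] [IsDomain R]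
    [UniqueFactorizationMonoid R] [CharZero R] {P : Polynomial R} (hP : P ≠ 0) :
    (∃ ρ : R, ρ ≠ 0 ∧ ∃ A B : Polynomial R, A * P + B * derivative P = Polynomial.C ρ) ∨
      ∃ D : Polynomial R, Irreducible D ∧ 0 < D.natDegree ∧ D * D ∣ P := by
  refine (exists_mul_add_mul_eq_C_or_irreducible_dvd (derivative P) hP).imp_right ?_
  rintro ⟨D, hD, hdeg, ⟨Q, rfl⟩, hd⟩
  refine ⟨D, hD, hdeg, mul_dvd_mul_left D ?_⟩
  rw [derivative_mul, dvd_add_left (dvd_mul_right _ _)] at hd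
  refine (hD.prime.dvd_or_dvd hd).resolve_left fun h => ?_
  have h0 : derivative D ≠ 0 := fun h0 => hdeg.ne' (derivative_eq_zero.1 h0)
  exact absurd (natDegree_le_of_dvd h h0) (not_le.2 (natDegree_derivative_lt hdeg.ne'))

theorem Polynomial.exists_eval_ne_zero_of_ne_zero {R : Type*} [CommRing R] [IsDomain R] [Infinite R]
    {P : Polynomial R} (hP : P ≠ 0) : ∃ t, P.eval t ≠ 0 := by
  by_contra! h
  exact hP (Polynomial.funext fun t => by simp [h t])

theorem MvPolynomial.exists_eval_ne_zero_of_ne_zero {σ R : Type*} [CommRing R] [IsDomain R]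
    [Infinite R] {P : MvPolynomial σ R} (hP : P ≠ 0) : ∃ z, eval z P ≠ 0 := by
  by_contra! h
  exact hP (MvPolynomial.funext fun t => by simp [h t])

/-- If a bivariate polynomial has, away from finitely many values of either variable, no multiple
roots in the inner variable, then it is generically separable in the outer variable. -/
theorem Polynomial.exists_separable_map_evalRingHom {N : Polynomial (Polynomial ℂ)}
    {α β : Polynomial ℂ} (hα : α ≠ 0) (hβ : β ≠ 0) (hN : ∀ s, N.eval (C s) ≠ 0)
    (hsq : ∀ s l, α.eval s ≠ 0 → β.eval l ≠ 0 → ¬ (X - C l) * (X - C l) ∣ N.eval (C s)) :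
    ∃ ρ : Polynomial ℂ, ρ ≠ 0 ∧ ∀ l, ρ.eval l ≠ 0 → (N.map (evalRingHom l)).Separable := by
  have hN0 : N ≠ 0 := fun h => hN 0 (by simp [h])
  rcases exists_mul_add_derivative_eq_C_or_sq_dvd hN0 with ⟨ρ, hρ, A, B, h⟩ | ⟨D, hD, hdeg, hdvd⟩
  · refine ⟨ρ, hρ, fun l hl => ?_⟩
    have h1 := congrArg (Polynomial.map (evalRingHom l)) h
    simp only [Polynomial.map_add, Polynomial.map_mul, Polynomial.map_C, coe_evalRingHom] at h1
    rw [← derivative_map] at h1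
    refine ⟨C (ρ.eval l)⁻¹ * A.map (evalRingHom l), C (ρ.eval l)⁻¹ * B.map (evalRingHom l), ?_⟩
    rw [mul_assoc, mul_assoc, ← mul_add, h1, ← C_mul, inv_mul_cancel₀ hl, C_1]
  · exfalso
    have hDs : ∀ s, D.eval (C s) ≠ 0 := fun s h0 => by
      obtain ⟨Q, hQ⟩ := hdvd
      exact hN s (by rw [hQ]; simp [h0])
    obtain ⟨l, hl⟩ := exists_eval_ne_zero_of_ne_zero (P := D.leadingCoeff * β *
      ∏ s ∈ α.roots.toFinset, D.eval (C s))
      (mul_ne_zero (mul_ne_zero (leadingCoeff_ne_zero.2 hD.ne_zero) hβ)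
        (Finset.prod_ne_zero_iff.2 fun s _ => hDs s))
    simp only [eval_mul, eval_prod, mul_ne_zero_iff, Finset.prod_ne_zero_iff] at hl
    obtain ⟨⟨hl1, hl2⟩, hl3⟩ := hl
    obtain ⟨s, hs⟩ := Complex.exists_root (f := D.map (evalRingHom l)) (by
      rw [← natDegree_pos_iff_degree_pos, natDegree_map_of_leadingCoeff_ne_zero _ hl1]
      exact hdeg)
    have hs' : (D.eval (C s)).eval l = 0 := by
      rw [IsRoot.def, eval_map] at hs
      rw [← hs, ← coe_evalRingHom, ← eval₂_id (x := C s) (p := D), hom_eval₂]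
      simp
    refine hsq s l (fun h0 => ?_) hl2 ?_
    · exact hl3 s (by simp [hα, h0]) hs'
    · have h1 : X - C l ∣ D.eval (C s) := dvd_iff_isRoot.2 hs'
      refine (mul_dvd_mul h1 h1).trans ?_
      obtain ⟨Q, hQ⟩ := hdvd
      rw [hQ, eval_mul, eval_mul]
      exact dvd_mul_right _ _

theorem Polynomial.not_sq_dvd_multiset_prod {ι K : Type*} [Field K] (f : ι → Polynomial K) (a : K)
    (m : Multiset ι) (hm : m.Nodup) (hsq : ∀ i ∈ m, ¬ (X - C a) * (X - C a) ∣ f i)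
    (hroot : ∀ i ∈ m, ∀ j ∈ m, i ≠ j → ¬ ((f i).eval a = 0 ∧ (f j).eval a = 0)) :
    ¬ (X - C a) * (X - C a) ∣ (m.map f).prod := by
  have hX : Prime (X - C a) := prime_X_sub_C a
  have key : ∀ P Q : Polynomial K, Q.eval a ≠ 0 → (X - C a) * (X - C a) ∣ P * Q →
      (X - C a) * (X - C a) ∣ P := fun P Q hQ h => by
    rw [← pow_two] at h ⊢
    refine IsCoprime.dvd_of_dvd_mul_right ?_ h
    exact IsCoprime.pow_left ((hX.irreducible.coprime_iff_not_dvd).2 (mt dvd_iff_isRoot.1 hQ))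
  induction m using Multiset.induction_on with
  | empty =>
    intro h
    simp only [Multiset.map_zero, Multiset.prod_zero] at h
    exact hX.not_isUnit (isUnit_of_dvd_one ((dvd_mul_right _ _).trans h))
  | cons i m ih =>
    rw [Multiset.nodup_cons] at hm
    intro h
    rw [Multiset.map_cons, Multiset.prod_cons] at h
    by_cases hi : (f i).eval a = 0
    · refine hsq i (by simp) (key _ _ ?_ h)
      rw [eval_multiset_prod, Multiset.map_map, Ne, Multiset.prod_eq_zero_iff, Multiset.mem_map]
      rintro ⟨j, hj, hj0⟩
      exact hroot i (by simp) j (by simp [hj]) (fun hij => hm.1 (hij ▸ hj)) ⟨hi, hj0⟩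
    · rw [mul_comm (f i)] at h
      exact ih hm.2 (fun j hj => hsq j (by simp [hj]))
        (fun j hj k hk => hroot j (by simp [hj]) k (by simp [hk])) (key _ _ hi h)

theorem Polynomial.natDegree_eq_of_eval_eq_pow_mul_eval_inv {K : Type*} [Field K] [Infinite K]
    {P M : Polynomial K} {k : ℕ} (h : ∀ s ≠ 0, P.eval s = s ^ k * M.eval s⁻¹)
    (hM : M.eval 0 ≠ 0) : P.natDegree = k ∧ P.leadingCoeff = M.eval 0 := by
  have hM0 : M ≠ 0 := fun h0 => hM (by simp [h0])
  have hc : M.coeff 0 ≠ 0 := by rwa [coeff_zero_eq_eval_zero]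
  have hX : X * (X ^ M.natDegree * P) = X * (X ^ k * M.reverse) := Polynomial.funext fun s => by
    rcases eq_or_ne s 0 with rfl | hs
    · simp
    · let _ := invertibleOfNonzero (inv_ne_zero hs)
      have h1 := eval₂_reverse_mul_pow (RingHom.id K) s⁻¹ M
      rw [eval₂_id, invOf_eq_inv, inv_inv, eval₂_id] at h1
      have h2 : s⁻¹ ^ M.natDegree * s ^ M.natDegree = 1 := by
        rw [← mul_pow, inv_mul_cancel₀ hs, one_pow]
      simp only [eval_mul, eval_pow, eval_X]
      rw [h s hs, ← h1]
      linear_combination s * s ^ k * M.reverse.eval s * h2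
  have h1 := mul_left_cancel₀ X_ne_zero hX
  have hr : M.reverse ≠ 0 := by simpa using hM0
  have hP : P ≠ 0 := by
    rintro rfl
    rw [mul_zero] at h1
    exact mul_ne_zero (pow_ne_zero _ X_ne_zero) hr h1.symm
  have ht : M.natTrailingDegree = 0 := natTrailingDegree_eq_zero.2 (Or.inr hc)
  constructor
  · have h2 := congrArg natDegree h1
    rw [natDegree_mul (pow_ne_zero _ X_ne_zero) hP, natDegree_mul (pow_ne_zero _ X_ne_zero) hr,
      natDegree_X_pow, natDegree_X_pow, reverse_natDegree, ht] at h2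
    omega
  · have h2 := congrArg leadingCoeff h1
    rw [leadingCoeff_mul, leadingCoeff_mul, leadingCoeff_X_pow, leadingCoeff_X_pow, one_mul,
      one_mul, reverse_leadingCoeff] at h2
    rw [h2, trailingCoeff, ht, coeff_zero_eq_eval_zero]

namespace MvPolynomial

variable {σ : Type*}

/-- The substitution `z ↦ z + T • k`, as a polynomial in `T`. -/
def lineShift (k : σ → ℂ) : MvPolynomial σ ℂ →+* Polynomial (MvPolynomial σ ℂ) :=
  (aeval fun i => Polynomial.C (X i) + Polynomial.C (C (k i)) * Polynomial.X :
    MvPolynomial σ ℂ →ₐ[ℂ] Polynomial (MvPolynomial σ ℂ)).toRingHom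

@[simp]
theorem lineShift_X (k : σ → ℂ) (i : σ) :
    lineShift k (X i) = Polynomial.C (X i) + Polynomial.C (C (k i)) * Polynomial.X := by
  simp [lineShift]

@[simp]
theorem lineShift_C (k : σ → ℂ) (c : ℂ) : lineShift k (C c) = Polynomial.C (C c) := by
  simp [lineShift]

theorem eval₂_lineShift_neg (k : σ → ℂ) (F : MvPolynomial σ ℂ) :
    Polynomial.eval₂ (lineShift (-k)) Polynomial.X (lineShift k F) = Polynomial.C F := by
  have h : ((Polynomial.eval₂RingHom (lineShift (-k)) Polynomial.X).comp (lineShift k)) =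
      (Polynomial.C : MvPolynomial σ ℂ →+* _) := by
    refine ringHom_ext (fun c => by simp) fun i => ?_
    simp only [RingHom.comp_apply, lineShift_X, Polynomial.coe_eval₂RingHom, Polynomial.eval₂_add,
      Polynomial.eval₂_mul, Polynomial.eval₂_C, Polynomial.eval₂_X, lineShift_C, Pi.neg_apply,
      map_neg]
    ring
  exact RingHom.congr_fun h F

theorem eval₂_lineShift_eval₂_lineShift_neg (k : σ → ℂ) (P : Polynomial (MvPolynomial σ ℂ)) :
    Polynomial.eval₂ (lineShift k) Polynomial.X
      (Polynomial.eval₂ (lineShift (-k)) Polynomial.X P) = P := by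
  have h : (Polynomial.eval₂RingHom (lineShift k) Polynomial.X).comp
      (Polynomial.eval₂RingHom (lineShift (-k)) Polynomial.X) = RingHom.id _ := by
    refine Polynomial.ringHom_ext (fun F => ?_) (by simp)
    simpa using eval₂_lineShift_neg (-k) F
  exact RingHom.congr_fun h P

theorem lineShift_ne_zero {k : σ → ℂ} {F : MvPolynomial σ ℂ} (hF : F ≠ 0) : lineShift k F ≠ 0 := by
  intro h
  have := eval₂_lineShift_neg k F
  rw [h, Polynomial.eval₂_zero] at this
  exact hF (Polynomial.C_eq_zero.1 this.symm)

/-- Divisors of `lineShift k F` come from divisors of `F`. -/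
theorem exists_eval₂_eq_C_of_dvd_lineShift {k : σ → ℂ} {F : MvPolynomial σ ℂ} (hF : F ≠ 0)
    {D : Polynomial (MvPolynomial σ ℂ)} (hD : D ∣ lineShift k F) :
    ∃ D', Polynomial.eval₂ (lineShift (-k)) Polynomial.X D = Polynomial.C D' := by
  have h := map_dvd (Polynomial.eval₂RingHom (lineShift (-k)) Polynomial.X) hD
  simp only [Polynomial.coe_eval₂RingHom, eval₂_lineShift_neg] at h
  refine ⟨_, Polynomial.eq_C_of_natDegree_eq_zero ?_⟩
  have := Polynomial.natDegree_le_of_dvd h (Polynomial.C_ne_zero.2 hF)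
  simpa using this

/-- The restriction of `F` to the parametrized line `t ↦ z + t • k`. -/
def restrictLine (F : MvPolynomial σ ℂ) (z k : σ → ℂ) : Polynomial ℂ :=
  (lineShift k F).map (eval z)

@[simp]
theorem eval_restrictLine (F : MvPolynomial σ ℂ) (z k : σ → ℂ) (t : ℂ) :
    (restrictLine F z k).eval t = eval (z + t • k) F := by
  have h : (Polynomial.evalRingHom t).comp
      ((Polynomial.mapRingHom (eval z)).comp (lineShift k)) = eval (z + t • k) := by
    refine ringHom_ext (fun c => by simp) fun i => ?_
    simp [mul_comm t]
  exact RingHom.congr_fun h F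

theorem exists_separable_restrictLine {F : MvPolynomial σ ℂ} (hF : Squarefree F) (k : σ → ℂ) :
    ∃ ρ : MvPolynomial σ ℂ, ρ ≠ 0 ∧ ∀ z, eval z ρ ≠ 0 → (restrictLine F z k).Separable := by
  have hF0 := hF.ne_zero
  rcases Polynomial.exists_mul_add_derivative_eq_C_or_sq_dvd (lineShift_ne_zero (k := k) hF0) with
    ⟨ρ, hρ, A, B, h⟩ | ⟨D, hD, -, hdvd⟩
  · refine ⟨ρ, hρ, fun z hz => ?_⟩
    have h1 := congrArg (Polynomial.map (eval z)) h
    simp only [Polynomial.map_add, Polynomial.map_mul, Polynomial.map_C] at h1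
    rw [← Polynomial.derivative_map] at h1
    refine ⟨Polynomial.C (eval z ρ)⁻¹ * A.map (eval z),
      Polynomial.C (eval z ρ)⁻¹ * B.map (eval z), ?_⟩
    rw [mul_assoc, mul_assoc, ← mul_add, restrictLine, h1, ← Polynomial.C_mul,
      inv_mul_cancel₀ hz, Polynomial.C_1]
  · exfalso
    obtain ⟨D', hD'⟩ := exists_eval₂_eq_C_of_dvd_lineShift hF0 ((dvd_mul_right D D).trans hdvd)
    have h := map_dvd (Polynomial.eval₂RingHom (lineShift (-k)) Polynomial.X) hdvd
    simp only [map_mul, Polynomial.coe_eval₂RingHom, eval₂_lineShift_neg, hD'] at h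
    rw [← Polynomial.C_mul, Polynomial.C_dvd_iff_dvd_coeff] at h
    have h2 : IsUnit D' := hF D' (by simpa using h 0)
    apply hD.not_isUnit
    rw [← eval₂_lineShift_eval₂_lineShift_neg k D, hD', Polynomial.eval₂_C]
    exact h2.map _

theorem exists_isCoprime_restrictLine {E r : MvPolynomial σ ℂ} (hE : Irreducible E)
    (hr : ¬ E ∣ r) (k : σ → ℂ) :
    ∃ ρ : MvPolynomial σ ℂ, ρ ≠ 0 ∧
      ∀ z, eval z ρ ≠ 0 → IsCoprime (restrictLine E z k) (restrictLine r z k) := by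
  rcases Polynomial.exists_mul_add_mul_eq_C_or_irreducible_dvd (lineShift k r)
    (lineShift_ne_zero (k := k) hE.ne_zero) with ⟨ρ, hρ, A, B, h⟩ | ⟨D, hD, -, hdvd, hdvd'⟩
  · refine ⟨ρ, hρ, fun z hz => ?_⟩
    have h1 := congrArg (Polynomial.map (eval z)) h
    simp only [Polynomial.map_add, Polynomial.map_mul, Polynomial.map_C] at h1
    refine ⟨Polynomial.C (eval z ρ)⁻¹ * A.map (eval z),
      Polynomial.C (eval z ρ)⁻¹ * B.map (eval z), ?_⟩
    rw [mul_assoc, mul_assoc, ← mul_add, restrictLine, restrictLine, h1, ← Polynomial.C_mul,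
      inv_mul_cancel₀ hz, Polynomial.C_1]
  · exfalso
    obtain ⟨D', hD'⟩ := exists_eval₂_eq_C_of_dvd_lineShift hE.ne_zero hdvd
    have key : ∀ f, D ∣ lineShift k f → D' ∣ f := fun f hf => by
      have h := map_dvd (Polynomial.eval₂RingHom (lineShift (-k)) Polynomial.X) hf
      simp only [Polynomial.coe_eval₂RingHom, eval₂_lineShift_neg, hD'] at h
      rw [Polynomial.C_dvd_iff_dvd_coeff] at h
      simpa using h 0
    rcases hE.dvd_iff.1 (key _ hdvd) with h2 | h2
    · apply hD.not_isUnit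
      rw [← eval₂_lineShift_eval₂_lineShift_neg k D, hD', Polynomial.eval₂_C]
      exact h2.map _
    · exact hr (h2.dvd.trans (key _ hdvd'))

theorem IsWeightedHomogeneous.eval_pow_mul {w : σ → ℕ} {n : ℕ} {φ : MvPolynomial σ ℂ}
    (h : φ.IsWeightedHomogeneous w n) (c : ℂ) (z : σ → ℂ) :
    eval (fun i => c ^ w i * z i) φ = c ^ n * eval z φ := by
  rw [eval_eq, eval_eq, Finset.mul_sum]
  refine Finset.sum_congr rfl fun d hd => ?_
  have h1 := h (mem_support_iff.1 hd)
  simp only [mul_pow, Finset.prod_mul_distrib, ← pow_mul, Finset.prod_pow_eq_pow_sum]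
  rw [← h1, Finsupp.weight_apply, Finsupp.sum]
  simp only [smul_eq_mul, mul_comm (w _)]
  ring

theorem IsHomogeneous.eval_smul_s7 {n : ℕ} {φ : MvPolynomial σ ℂ}
    (h : φ.IsHomogeneous n) (c : ℂ) (z : σ → ℂ) :
    eval (c • z) φ = c ^ n * eval z φ := by
  rw [← IsWeightedHomogeneous.eval_pow_mul h c z]
  congr 2
  ext i
  simp

theorem IsHomogeneous.natDegree_restrictLine {n : ℕ} {φ : MvPolynomial σ ℂ}
    (h : φ.IsHomogeneous n) (z : σ → ℂ) {k : σ → ℂ} (hk : eval k φ ≠ 0) :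
    (restrictLine φ z k).natDegree = n ∧ (restrictLine φ z k).leadingCoeff = eval k φ := by
  have := Polynomial.natDegree_eq_of_eval_eq_pow_mul_eval_inv (P := restrictLine φ z k)
    (M := restrictLine φ k z) (k := n) (fun s hs => ?_) (by simpa using hk)
  · simpa using this
  · rw [eval_restrictLine, eval_restrictLine, ← h.eval_smul_s7, smul_add, smul_smul,
      mul_inv_cancel₀ hs, one_smul, add_comm]

variable {τ : Type*}

/-- The norm of `G` along the family of zero sets of `E` on lines in direction `o`. -/
theorem IsHomogeneous.exists_eval_eq_prod_roots {n : ℕ} {E : MvPolynomial τ ℂ}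
    (hE : E.IsHomogeneous n) {o : τ → ℂ} (ho : eval o E ≠ 0) (G : MvPolynomial (σ ⊕ τ) ℂ) :
    ∃ (N : MvPolynomial (σ ⊕ τ) ℂ) (c : ℂ), c ≠ 0 ∧ ∀ x y, eval (Sum.elim x y) N =
      c * ((restrictLine E y o).roots.map fun t => eval (Sum.elim x (y + t • o)) G).prod := by
  set f := lineShift (Sum.elim 0 o) (rename Sum.inr E : MvPolynomial (σ ⊕ τ) ℂ)
  set g := lineShift (Sum.elim 0 o) G
  refine ⟨Polynomial.resultant f g n g.natDegree, eval o E ^ g.natDegree, pow_ne_zero _ ho,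
    fun x y => ?_⟩
  have hf : f.map (eval (Sum.elim x y)) = restrictLine E y o := Polynomial.funext fun t => by
    have := eval_restrictLine (rename Sum.inr E : MvPolynomial (σ ⊕ τ) ℂ)
      (Sum.elim x y) (Sum.elim 0 o) t
    rw [restrictLine] at this
    rw [this, eval_restrictLine, eval_rename]
    rfl
  have hg : ∀ t, (g.map (eval (Sum.elim x y))).eval t = eval (Sum.elim x (y + t • o)) G :=
    fun t => by
      have := eval_restrictLine G (Sum.elim x y) (Sum.elim 0 o) t
      rw [restrictLine] at this
      rw [this]
      congr 2
      ext i
      cases i <;> simp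
  obtain ⟨h1, h2⟩ := hE.natDegree_restrictLine y ho
  rw [← Polynomial.resultant_map_map, hf]
  have := Polynomial.resultant_eq_prod_eval (restrictLine E y o) (g.map (eval (Sum.elim x y)))
    g.natDegree Polynomial.natDegree_map_le (IsAlgClosed.splits _)
  rw [h1, h2] at this
  rw [this]
  simp only [hg]

theorem IsHomogeneous.roots_restrictLine_smul {n : ℕ} {E : MvPolynomial τ ℂ}
    (hE : E.IsHomogeneous n) {o : τ → ℂ} (ho : eval o E ≠ 0) (y : τ → ℂ) {s : ℂ} (hs : s ≠ 0) :
    (restrictLine E (s • y) o).roots = (restrictLine E y o).roots.map (s * ·) := by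
  obtain ⟨h1, h2⟩ := hE.natDegree_restrictLine y ho
  have hsp := IsAlgClosed.splits (restrictLine E y o)
  have hcard := hsp.natDegree_eq_card_roots
  have h3 := hsp.eq_prod_roots
  rw [h2] at h3
  have key : restrictLine E (s • y) o = Polynomial.C (eval o E) *
      (((restrictLine E y o).roots.map (s * ·)).map (Polynomial.X - Polynomial.C ·)).prod := by
    refine Polynomial.funext fun t => ?_
    have h4 : s • y + t • o = s • (y + (s⁻¹ * t) • o) := by
      rw [smul_add, smul_smul, mul_inv_cancel_left₀ hs]
    have h5 := congrArg (Polynomial.eval (s⁻¹ * t)) h3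
    rw [eval_restrictLine] at h5
    rw [eval_restrictLine, h4, hE.eval_smul_s7, h5]
    simp only [Polynomial.eval_mul, Polynomial.eval_C, Polynomial.eval_multiset_prod,
      Multiset.map_map, Function.comp_def, Polynomial.eval_sub, Polynomial.eval_X]
    have h6 : s ^ n = ((restrictLine E y o).roots.map fun _ => s).prod := by
      rw [Multiset.map_const', Multiset.prod_replicate, ← hcard, h1]
    rw [mul_left_comm, h6, ← Multiset.prod_map_mul]
    simp only [mul_sub, mul_inv_cancel_left₀ hs]
  rw [key, Polynomial.roots_C_mul _ ho, Polynomial.roots_multiset_prod_X_sub_C]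

theorem eval_smul_eq_of_eval_eq_prod_roots {n b : ℕ} {E : MvPolynomial τ ℂ}
    (hE : E.IsHomogeneous n) {o : τ → ℂ} (ho : eval o E ≠ 0) {G N : MvPolynomial (σ ⊕ τ) ℂ}
    (hG : ∀ x y (s : ℂ), eval (Sum.elim x (s • y)) G = s ^ b * eval (Sum.elim x y) G) {c : ℂ}
    (hN : ∀ x y, eval (Sum.elim x y) N =
      c * ((restrictLine E y o).roots.map fun t => eval (Sum.elim x (y + t • o)) G).prod)
    (x : σ → ℂ) (y : τ → ℂ) {s : ℂ} (hs : s ≠ 0) :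
    eval (Sum.elim x (s • y)) N = s ^ (b * n) * eval (Sum.elim x y) N := by
  obtain ⟨h1, -⟩ := hE.natDegree_restrictLine y ho
  have hcard := (IsAlgClosed.splits (restrictLine E y o)).natDegree_eq_card_roots
  rw [hN, hN, hE.roots_restrictLine_smul ho y hs, Multiset.map_map]
  have : ((fun t => eval (Sum.elim x (s • y + t • o)) G) ∘ (s * ·)) =
      fun t => s ^ b * eval (Sum.elim x (y + t • o)) G := by
    ext t
    simp only [Function.comp_apply, mul_smul, ← smul_add, hG]
  rw [this, Multiset.prod_map_mul, Multiset.map_const', Multiset.prod_replicate, ← hcard, h1,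
    ← pow_mul]
  ring

/-- Let `E` be a plane curve and suppose that the curves `G(p + l • q, ·) = 0` of the pencil spanned
by `p` and `q` have no common point on `E`. Under the genericity assumptions `hα`, `hu`, `hw`, `hne`
on the projection from `o`, a general member of the pencil meets `E` in at least two points. -/
theorem false_of_pencil {G : MvPolynomial (Fin 3 ⊕ Fin 3) ℂ} {a b e : ℕ}
    (hGx : ∀ x y (s : ℂ), eval (Sum.elim (s • x) y) G = s ^ a * eval (Sum.elim x y) G)
    (hGy : ∀ x y (s : ℂ), eval (Sum.elim x (s • y)) G = s ^ b * eval (Sum.elim x y) G)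
    {E : MvPolynomial (Fin 3) ℂ} (hE : E.IsHomogeneous e) (hbe : 2 ≤ b * e)
    {o p q u w : Fin 3 → ℂ} (ho : eval o E ≠ 0)
    (hpq : ∀ y ≠ 0, eval y E = 0 →
      ¬ (eval (Sum.elim p y) G = 0 ∧ eval (Sum.elim q y) G = 0))
    {α β : Polynomial ℂ} (hα0 : α ≠ 0) (hβ0 : β ≠ 0)
    (hα : ∀ s, α.eval s ≠ 0 → (restrictLine E (u + s • w) o).Separable ∧
      ∀ t : ℂ, eval (u + s • w + t • o) E = 0 →
        (restrictLine G (Sum.elim p (u + s • w + t • o)) (Sum.elim q 0)).Separable)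
    (hβ : ∀ l, β.eval l ≠ 0 → ∀ y y', eval y E = 0 → eval y' E = 0 → crossProduct y y' ≠ 0 →
      ¬ (eval (Sum.elim (p + l • q) y) G = 0 ∧ eval (Sum.elim (p + l • q) y') G = 0))
    (hu : ∀ s t : ℂ, u + s • w + t • o ≠ 0) (hw : ∀ t : ℂ, w + t • o ≠ 0)
    (hne : ∀ s t s' t' : ℂ, (s ≠ s' ∨ t ≠ t') →
      crossProduct (u + s • w + t • o) (u + s' • w + t' • o) ≠ 0) : False := by
  obtain ⟨N₀, c, hc, hN₀⟩ := hE.exists_eval_eq_prod_roots ho G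
  have hE0 : ∀ y, restrictLine E y o ≠ 0 := fun y h0 => ho (by
    rw [← (hE.natDegree_restrictLine y ho).2, h0, Polynomial.leadingCoeff_zero])
  have hmem : ∀ y t, t ∈ (restrictLine E y o).roots ↔ eval (y + t • o) E = 0 := fun y t => by
    rw [Polynomial.mem_roots (hE0 y), Polynomial.IsRoot.def, eval_restrictLine]
  have hline : ∀ y (l : ℂ), (restrictLine G (Sum.elim p y) (Sum.elim q 0)).eval l =
      eval (Sum.elim (p + l • q) y) G := fun y l => by
    rw [eval_restrictLine]
    congr 2
    ext i
    cases i <;> simp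
  set Φ : (Fin 3 → ℂ) → Polynomial ℂ := fun y => Polynomial.C c *
    ((restrictLine E y o).roots.map fun t =>
      restrictLine G (Sum.elim p (y + t • o)) (Sum.elim q 0)).prod with hΦ
  have hΦe : ∀ y l, (Φ y).eval l = eval (Sum.elim (p + l • q) y) N₀ := fun y l => by
    rw [hN₀, hΦ]
    simp only [Polynomial.eval_mul, Polynomial.eval_C, Polynomial.eval_multiset_prod,
      Multiset.map_map, Function.comp_def, hline]
  have hGl : ∀ y ≠ 0, eval y E = 0 → restrictLine G (Sum.elim p y) (Sum.elim q 0) ≠ 0 := by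
    intro y hy hEy h0
    refine hpq y hy hEy ⟨by simpa [h0] using (hline y 0).symm, ?_⟩
    by_contra hq
    have := (Polynomial.natDegree_eq_of_eval_eq_pow_mul_eval_inv
      (P := restrictLine G (Sum.elim p y) (Sum.elim q 0))
      (M := restrictLine G (Sum.elim q y) (Sum.elim p 0)) (k := a) (fun s hs => ?_)
      (by simpa using hq)).2
    · rw [h0] at this
      exact hq (by simpa using this.symm)
    · rw [hline, eval_restrictLine]
      have h1 : Sum.elim q y + s⁻¹ • Sum.elim p 0 = Sum.elim (q + s⁻¹ • p) y := by
        ext i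
        cases i <;> simp
      rw [h1, ← hGx, smul_add, smul_smul, mul_inv_cancel₀ hs, one_smul, add_comm]
  have hΦ0 : ∀ y, (∀ t : ℂ, y + t • o ≠ 0) → Φ y ≠ 0 := by
    intro y hy
    refine mul_ne_zero (Polynomial.C_ne_zero.2 hc) fun h0 => ?_
    obtain ⟨t, ht, ht0⟩ := Multiset.mem_map.1 (Multiset.prod_eq_zero_iff.1 h0)
    exact hGl _ (hy t) ((hmem _ _).1 ht) ht0
  set N : Polynomial (Polynomial ℂ) := aeval (Sum.elim
    (fun i => Polynomial.C (Polynomial.C (p i) + Polynomial.C (q i) * Polynomial.X))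
    (fun i => Polynomial.C (Polynomial.C (u i)) +
      Polynomial.C (Polynomial.C (w i)) * Polynomial.X)) N₀
  have hNmap : ∀ l s, (N.map (Polynomial.evalRingHom l)).eval s =
      eval (Sum.elim (p + l • q) (u + s • w)) N₀ := fun l s => by
    have h : ((Polynomial.evalRingHom s).comp (Polynomial.mapRingHom
        (Polynomial.evalRingHom l))).comp (aeval (Sum.elim
        (fun i => Polynomial.C (Polynomial.C (p i) + Polynomial.C (q i) * Polynomial.X))
        (fun i => Polynomial.C (Polynomial.C (u i)) +
        Polynomial.C (Polynomial.C (w i)) * Polynomial.X)) :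
          MvPolynomial (Fin 3 ⊕ Fin 3) ℂ →ₐ[ℂ] Polynomial (Polynomial ℂ)).toRingHom =
        eval (Sum.elim (p + l • q) (u + s • w)) := by
      refine ringHom_ext (fun c => by simp) fun i => ?_
      rcases i with i | i <;> simp [mul_comm l, mul_comm s]
    exact RingHom.congr_fun h N₀
  have hNC : ∀ s, N.eval (Polynomial.C s) = Φ (u + s • w) := fun s =>
    Polynomial.funext fun l => by
      rw [hΦe, ← hNmap, Polynomial.eval_map, ← Polynomial.coe_evalRingHom l,
        ← Polynomial.eval₂_id (x := Polynomial.C s) (p := N), Polynomial.hom_eval₂]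
      simp
  obtain ⟨ρ, hρ0, hρ⟩ := Polynomial.exists_separable_map_evalRingHom (N := N) hα0 hβ0
    (fun s => by rw [hNC]; exact hΦ0 _ (hu s)) (by
      intro s l hs hl
      rw [hNC, hΦ, Polynomial.dvd_C_mul hc]
      obtain ⟨h1, h2⟩ := hα s hs
      refine Polynomial.not_sq_dvd_multiset_prod _ _ _ (Polynomial.nodup_roots h1) ?_ ?_
      · intro t ht h
        exact (Polynomial.prime_X_sub_C l).not_isUnit ((h2 t ((hmem _ _).1 ht)).squarefree _ h)
      · intro t ht t' ht' htt
        simp only [hline]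
        exact hβ l hl _ _ ((hmem _ _).1 ht) ((hmem _ _).1 ht') (hne _ _ _ _ (Or.inr htt)))
  obtain ⟨l, hl⟩ := Polynomial.exists_eval_ne_zero_of_ne_zero
    (mul_ne_zero (mul_ne_zero hρ0 hβ0) (hΦ0 w hw))
  simp only [Polynomial.eval_mul, mul_ne_zero_iff, hΦe] at hl
  obtain ⟨⟨hl1, hl2⟩, hl3⟩ := hl
  have hsep := hρ l hl1
  have hdeg := (Polynomial.natDegree_eq_of_eval_eq_pow_mul_eval_inv
    (P := N.map (Polynomial.evalRingHom l))
    (M := restrictLine N₀ (Sum.elim (p + l • q) w) (Sum.elim (0 : Fin 3 → ℂ) u)) (k := b * e)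
    (fun s hs => by
      have h1 : Sum.elim (p + l • q) w + s⁻¹ • Sum.elim (0 : Fin 3 → ℂ) u =
          Sum.elim (p + l • q) (w + s⁻¹ • u) := by
        ext i
        cases i <;> simp
      rw [hNmap, eval_restrictLine, h1, ← eval_smul_eq_of_eval_eq_prod_roots hE ho hGy hN₀ _ _ hs,
        smul_add, smul_smul, mul_inv_cancel₀ hs, one_smul, add_comm u]) (by simpa using hl3)).1
  set Q := N.map (Polynomial.evalRingHom l)
  rw [(IsAlgClosed.splits Q).natDegree_eq_card_roots,
    ← Multiset.toFinset_card_of_nodup (Polynomial.nodup_roots hsep)] at hdeg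
  obtain ⟨s, hs, s', hs', hss⟩ := Finset.one_lt_card.1 (lt_of_lt_of_le one_lt_two (hdeg ▸ hbe))
  have hex : ∀ s ∈ Q.roots.toFinset, ∃ t : ℂ, eval (u + s • w + t • o) E = 0 ∧
      eval (Sum.elim (p + l • q) (u + s • w + t • o)) G = 0 := by
    intro s hs
    rw [Multiset.mem_toFinset, Polynomial.mem_roots hsep.ne_zero, Polynomial.IsRoot.def, hNmap,
      hN₀, mul_eq_zero, or_iff_right hc, Multiset.prod_eq_zero_iff, Multiset.mem_map] at hs
    obtain ⟨t, ht, h0⟩ := hs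
    exact ⟨t, (hmem _ _).1 ht, h0⟩
  obtain ⟨t, h1, h2⟩ := hex s hs
  obtain ⟨t', h3, h4⟩ := hex s' hs'
  exact hβ l hl2 _ _ h1 h3 (hne _ _ _ _ (Or.inl hss)) ⟨h2, h4⟩

variable {σ τ : Type*}

/-- The substitution `X i ↦ T ^ w i * X i`. -/
def weightGrading (w : σ → ℕ) : MvPolynomial σ ℂ →ₐ[ℂ] Polynomial (MvPolynomial σ ℂ) :=
  aeval fun i => Polynomial.C (X i) * Polynomial.X ^ w i

theorem weightGrading_monomial (w : σ → ℕ) (d : σ →₀ ℕ) (c : ℂ) :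
    weightGrading w (monomial d c) =
      Polynomial.C (monomial d c) * Polynomial.X ^ Finsupp.weight w d := by
  rw [weightGrading, aeval_monomial, monomial_eq]
  simp only [Finsupp.prod, mul_pow, Finset.prod_mul_distrib, map_mul, map_prod, map_pow,
    ← pow_mul, Finset.prod_pow_eq_pow_sum, Finsupp.weight_apply, Finsupp.sum, smul_eq_mul]
  rw [← mul_assoc]
  congr 2
  exact Finset.sum_congr rfl fun i _ => mul_comm _ _

theorem coeff_weightGrading (w : σ → ℕ) (φ : MvPolynomial σ ℂ) (j : ℕ) :
    (weightGrading w φ).coeff j = weightedHomogeneousComponent w j φ := by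
  induction φ using MvPolynomial.induction_on' with
  | monomial d c =>
    rw [weightGrading_monomial, Polynomial.coeff_C_mul_X_pow]
    have h := isWeightedHomogeneous_monomial w d c rfl
    rw [weightedHomogeneousComponent_of_mem h]
  | add p q hp hq => rw [map_add, map_add, Polynomial.coeff_add, hp, hq]

theorem IsWeightedHomogeneous.exists_of_dvd {w : σ → ℕ} {n : ℕ} {F P : MvPolynomial σ ℂ}
    (hF : F.IsWeightedHomogeneous w n) (hF0 : F ≠ 0) (h : P ∣ F) :
    ∃ k, P.IsWeightedHomogeneous w k := by
  obtain ⟨Q, rfl⟩ := h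
  have hgr : weightGrading w (P * Q) = Polynomial.monomial n (P * Q) := by
    ext1 j
    rw [coeff_weightGrading, Polynomial.coeff_monomial, weightedHomogeneousComponent_of_mem hF]
    split_ifs <;> first | rfl | omega
  have hne : weightGrading w P * weightGrading w Q ≠ 0 := by
    rw [← map_mul, hgr]
    simpa using hF0
  rw [map_mul] at hgr
  have h1 := congrArg Polynomial.natDegree hgr
  have h2 := congrArg Polynomial.natTrailingDegree hgr
  rw [Polynomial.natDegree_mul (left_ne_zero_of_mul hne) (right_ne_zero_of_mul hne),
    Polynomial.natDegree_monomial_eq _ hF0] at h1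
  rw [Polynomial.natTrailingDegree_mul (left_ne_zero_of_mul hne) (right_ne_zero_of_mul hne),
    Polynomial.natTrailingDegree_monomial hF0] at h2
  have h3 := Polynomial.natTrailingDegree_le_natDegree (weightGrading w P)
  have h4 := Polynomial.natTrailingDegree_le_natDegree (weightGrading w Q)
  refine ⟨(weightGrading w P).natDegree, ?_⟩
  have h5 : weightedHomogeneousComponent w (weightGrading w P).natDegree P = P := by
    conv_rhs => rw [← sum_weightedHomogeneousComponent w P]
    rw [finsum_eq_single _ (weightGrading w P).natDegree]
    intro j hj
    rw [← coeff_weightGrading]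
    rcases lt_or_gt_of_ne hj with h | h
    · exact Polynomial.coeff_eq_zero_of_lt_natTrailingDegree (by omega)
    · exact Polynomial.coeff_eq_zero_of_natDegree_lt h
  have h6 := weightedHomogeneousComponent_isWeightedHomogeneous (w := w)
    (weightGrading w P).natDegree P
  rwa [h5] at h6

theorem IsWeightedHomogeneous.isHomogeneous_aeval {w : σ → ℕ} {n : ℕ} {φ : MvPolynomial σ ℂ}
    (h : φ.IsWeightedHomogeneous w n) {g : σ → MvPolynomial τ ℂ}
    (hg : ∀ i, (g i).IsHomogeneous (w i)) : (aeval g φ).IsHomogeneous n := by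
  rw [aeval_def, eval₂_eq]
  refine IsHomogeneous.sum _ _ _ fun d hd => ?_
  have h1 := h (mem_support_iff.1 hd)
  rw [Finsupp.weight_apply, Finsupp.sum] at h1
  rw [← zero_add n, ← h1]
  refine (isHomogeneous_C _ _).mul (IsHomogeneous.prod _ _ _ fun i _ => ?_)
  rw [smul_eq_mul, mul_comm]
  exact (hg i).pow _

/-- The specialization of `F` at `x`. -/
def sliceLeft (x : σ → ℂ) (F : MvPolynomial (σ ⊕ τ) ℂ) : MvPolynomial τ ℂ :=
  aeval (Sum.elim (fun i => C (x i)) X) F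

/-- The specialization of `F` at `y`. -/
def sliceRight (y : τ → ℂ) (F : MvPolynomial (σ ⊕ τ) ℂ) : MvPolynomial σ ℂ :=
  aeval (Sum.elim X (fun i => C (y i))) F

@[simp]
theorem eval_sliceLeft (x : σ → ℂ) (y : τ → ℂ) (F : MvPolynomial (σ ⊕ τ) ℂ) :
    eval y (sliceLeft x F) = eval (Sum.elim x y) F := by
  have h : (eval y).comp (aeval (Sum.elim (fun i => C (x i)) X) :
      MvPolynomial (σ ⊕ τ) ℂ →ₐ[ℂ] MvPolynomial τ ℂ).toRingHom = eval (Sum.elim x y) := by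
    refine ringHom_ext (fun c => by simp) fun i => ?_
    rcases i with i | i <;> simp
  exact RingHom.congr_fun h F

@[simp]
theorem eval_sliceRight (x : σ → ℂ) (y : τ → ℂ) (F : MvPolynomial (σ ⊕ τ) ℂ) :
    eval x (sliceRight y F) = eval (Sum.elim x y) F := by
  have h : (eval x).comp (aeval (Sum.elim X (fun i => C (y i))) :
      MvPolynomial (σ ⊕ τ) ℂ →ₐ[ℂ] MvPolynomial σ ℂ).toRingHom = eval (Sum.elim x y) := by
    refine ringHom_ext (fun c => by simp) fun i => ?_
    rcases i with i | i <;> simp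
  exact RingHom.congr_fun h F

/-- The linear form with coefficients `n`. -/
def linearForm (n : Fin 3 → ℂ) : MvPolynomial (Fin 3) ℂ := ∑ i, C (n i) * X i

@[simp]
theorem eval_linearForm (n x : Fin 3 → ℂ) : eval x (linearForm n) = n ⬝ᵥ x := by
  simp [linearForm, dotProduct]

theorem linearForm_ne_zero {n : Fin 3 → ℂ} (hn : n ≠ 0) : linearForm n ≠ 0 := by
  intro h
  refine hn (_root_.funext fun i => ?_)
  have := eval_linearForm n (Pi.single i 1)
  simpa [h] using this.symm

theorem totalDegree_linearForm_le (n : Fin 3 → ℂ) : (linearForm n).totalDegree ≤ 1 :=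
  totalDegree_finsetSum_le fun i _ => (totalDegree_mul _ _).trans (by simp)

theorem exists_irreducible_dvd_of_eval_eq_zero {f : MvPolynomial σ ℂ} (hf : f ≠ 0) {z : σ → ℂ}
    (hz : eval z f = 0) : ∃ A, Irreducible A ∧ A ∣ f ∧ eval z A = 0 := by
  obtain ⟨m, hm, u, rfl⟩ := UniqueFactorizationMonoid.exists_prime_factors f hf
  rw [map_mul, mul_eq_zero, or_iff_left ((u.isUnit.map (eval z)).ne_zero), map_multiset_prod,
    Multiset.prod_eq_zero_iff, Multiset.mem_map] at hz
  obtain ⟨A, hA, hA0⟩ := hz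
  exact ⟨A, (hm A hA).irreducible, (Multiset.dvd_prod hA).mul_right _, hA0⟩

theorem exists_eval_eq_zero_of_not_dvd [Finite σ] {A g : MvPolynomial σ ℂ} (hA : Irreducible A)
    (hg : ¬ A ∣ g) : ∃ z, eval z A = 0 ∧ eval z g ≠ 0 := by
  by_contra! h
  have hp : (Ideal.span {A}).IsPrime := (Ideal.span_singleton_prime hA.ne_zero).2 hA.prime
  refine hg (Ideal.mem_span_singleton.1 ?_)
  rw [← IsPrime.vanishingIdeal_zeroLocus (K := ℂ) (Ideal.span {A})]
  intro z hz
  rw [aeval_eq_eval]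
  refine h z ?_
  rw [← aeval_eq_eval]
  exact hz A (Ideal.mem_span_singleton_self A)

theorem exists_linearForm_not_dvd {A : MvPolynomial (Fin 3) ℂ} (hA : ¬ IsUnit A) {v : Fin 3 → ℂ}
    (hv : v ≠ 0) : ∃ ℓ, ¬ A ∣ ℓ ∧ ∀ z, eval z ℓ ≠ 0 → crossProduct z v ≠ 0 := by
  by_contra! h
  have key : ∀ m, A ∣ linearForm (crossProduct v m) := fun m => by
    by_contra hm
    obtain ⟨z, hz, hz0⟩ := h _ hm
    apply hz
    rw [eval_linearForm, dotProduct_comm, triple_product_permutation, triple_product_permutation,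
      hz0]
    simp
  have hC : ∀ m, ∃ c, linearForm (crossProduct v m) = A * C c := fun m => by
    obtain ⟨B, hB⟩ := key m
    rcases eq_or_ne (A * B) 0 with h0 | h0
    · exact ⟨0, by rw [hB, h0]; simp⟩
    have h1 := totalDegree_linearForm_le (crossProduct v m)
    rw [hB, totalDegree_mul_of_isDomain (left_ne_zero_of_mul h0) (right_ne_zero_of_mul h0)] at h1
    have h2 : A.totalDegree ≠ 0 := fun h2 => hA (by
      rw [totalDegree_eq_zero_iff_eq_C.1 h2]
      refine (isUnit_iff_ne_zero.2 fun h3 => ?_).map C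
      rw [totalDegree_eq_zero_iff_eq_C.1 h2, h3] at h0
      simp at h0)
    exact ⟨_, by rw [hB, totalDegree_eq_zero_iff_eq_C.1 (by omega : B.totalDegree = 0)]⟩
  have hcross : ∀ m m' z z', (crossProduct v m ⬝ᵥ z) * (crossProduct v m' ⬝ᵥ z') =
      (crossProduct v m ⬝ᵥ z') * (crossProduct v m' ⬝ᵥ z) := fun m m' z z' => by
    obtain ⟨c, hc⟩ := hC m
    obtain ⟨c', hc'⟩ := hC m'
    simp only [← eval_linearForm, hc, hc', map_mul, eval_C]
    ring
  have h0 := hcross (Pi.single 1 1) (Pi.single 2 1) (Pi.single 2 1) (Pi.single 1 1)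
  have h1 := hcross (Pi.single 2 1) (Pi.single 0 1) (Pi.single 0 1) (Pi.single 2 1)
  have h2 := hcross (Pi.single 0 1) (Pi.single 1 1) (Pi.single 1 1) (Pi.single 0 1)
  simp [cross_apply] at h0 h1 h2
  exact hv (_root_.funext fun i => by fin_cases i <;> assumption)

/-- An irreducible curve has points off any other curve and off any finite set. -/
theorem exists_eval_eq_zero_and_crossProduct_ne_zero {A g : MvPolynomial (Fin 3) ℂ}
    (hA : Irreducible A) (hg : ¬ A ∣ g) (V : Finset (Fin 3 → ℂ)) (hV : ∀ v ∈ V, v ≠ 0) :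
    ∃ z, eval z A = 0 ∧ eval z g ≠ 0 ∧ ∀ v ∈ V, crossProduct z v ≠ 0 := by
  choose! ℓ hℓ hℓ' using fun v (hv : v ∈ V) => exists_linearForm_not_dvd hA.not_isUnit (hV v hv)
  obtain ⟨z, hz, hz'⟩ := exists_eval_eq_zero_of_not_dvd (g := g * ∏ v ∈ V, ℓ v) hA fun h => by
    rcases hA.prime.dvd_or_dvd h with h | h
    · exact hg h
    · obtain ⟨v, hv, h⟩ := (hA.prime.dvd_finsetProd_iff _).1 h
      exact hℓ v hv h
  simp only [map_mul, map_prod, mul_ne_zero_iff, Finset.prod_ne_zero_iff] at hz'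
  exact ⟨z, hz, hz'.1, fun v hv => hℓ' v hv z (hz'.2 v hv)⟩

theorem exists_linearForm_forall_crossProduct_ne_zero {v : Fin 3 → ℂ} (hv : v ≠ 0) :
    ∃ ℓ : MvPolynomial (Fin 3) ℂ, ℓ ≠ 0 ∧ ∀ z, eval z ℓ ≠ 0 → crossProduct z v ≠ 0 := by
  obtain ⟨ℓ, h, h'⟩ := exists_linearForm_not_dvd (A := 0) not_isUnit_zero hv
  exact ⟨ℓ, fun h0 => h (zero_dvd_iff.2 h0), h'⟩

theorem exists_smul_eq_of_crossProduct_eq_zero {y z : Fin 3 → ℂ} (hy : y ≠ 0)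
    (h : crossProduct y z = 0) : ∃ c : ℂ, c • y = z := by
  have h1 : ¬ LinearIndependent ℂ ![y, z] :=
    fun h1 => crossProduct_ne_zero_iff_linearIndependent.2 h1 h
  rw [LinearIndependent.pair_iff' hy] at h1
  simpa using h1

theorem crossProduct_add_smul_add_smul_ne_zero {u w o : Fin 3 → ℂ}
    (h : crossProduct w o ⬝ᵥ u ≠ 0) {s t s' t' : ℂ} (hst : s ≠ s' ∨ t ≠ t') :
    crossProduct (u + s • w + t • o) (u + s' • w + t' • o) ≠ 0 := by
  intro h0
  have e0 := congrFun h0 0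
  have e1 := congrFun h0 1
  have e2 := congrFun h0 2
  simp only [cross_apply, Pi.add_apply, Pi.smul_apply, smul_eq_mul, Matrix.cons_val,
    Pi.zero_apply] at e0 e1 e2
  simp only [cross_apply, dotProduct, Fin.sum_univ_three, Matrix.cons_val] at h
  rcases hst with hs | ht
  · refine mul_ne_zero (sub_ne_zero.2 hs) h ?_
    linear_combination -(o 0 * e0 + o 1 * e1 + o 2 * e2)
  · refine mul_ne_zero (sub_ne_zero.2 ht) h ?_
    linear_combination w 0 * e0 + w 1 * e1 + w 2 * e2

/-- If `G` is squarefree of degree at least two in `y` and contains no plane over a point `y`, then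
its zero set contains a grid `{x, x'} × {y, y'}` with `g x ≠ 0` and `g x' ≠ 0`. -/
theorem false_of_squarefree {G : MvPolynomial (Fin 3 ⊕ Fin 3) ℂ} (hG : Squarefree G) {a b : ℕ}
    (hGr : ∀ y, (sliceRight y G).IsHomogeneous a) (hGl : ∀ x, (sliceLeft x G).IsHomogeneous b)
    (hb : 2 ≤ b) {g : MvPolynomial (Fin 3) ℂ} (hg : g ≠ 0)
    (hgrid : ∀ x x' y y', eval x g ≠ 0 → eval x' g ≠ 0 → crossProduct x x' ≠ 0 →
      crossProduct y y' ≠ 0 → eval (Sum.elim x y) G = 0 → eval (Sum.elim x y') G = 0 →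
      eval (Sum.elim x' y) G = 0 → eval (Sum.elim x' y') G ≠ 0)
    (hbase : ∀ y ≠ 0, ∃ x, eval (Sum.elim x y) G ≠ 0) : False := by
  have hGx : ∀ x y (s : ℂ), eval (Sum.elim (s • x) y) G = s ^ a * eval (Sum.elim x y) G :=
    fun x y s => by simpa using (hGr y).eval_smul_s7 s x
  have hGy : ∀ x y (s : ℂ), eval (Sum.elim x (s • y)) G = s ^ b * eval (Sum.elim x y) G :=
    fun x y s => by simpa using (hGl x).eval_smul_s7 s y
  have hGr0 : ∀ y ≠ 0, sliceRight y G ≠ 0 := fun y hy h0 => by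
    obtain ⟨x, hx⟩ := hbase y hy
    exact hx (by rw [← eval_sliceRight, h0, map_zero])
  obtain ⟨q, hq⟩ := exists_eval_ne_zero_of_ne_zero (mul_ne_zero hg (X_ne_zero (0 : Fin 3)))
  rw [map_mul, eval_X, mul_ne_zero_iff] at hq
  have hq0 : q ≠ 0 := fun h => hq.2 (by simp [h])
  obtain ⟨ℓ, hℓ, hℓ'⟩ := exists_linearForm_forall_crossProduct_ne_zero hq0
  obtain ⟨ρ, hρ, hρ'⟩ := exists_separable_restrictLine hG (Sum.elim q 0)
  obtain ⟨z', hz'⟩ := exists_eval_ne_zero_of_ne_zero (mul_ne_zero hρ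
    ((map_ne_zero_iff _ (rename_injective (Sum.inl : Fin 3 → Fin 3 ⊕ Fin 3)
      Sum.inl_injective)).2 (mul_ne_zero hg hℓ)))
  obtain ⟨p, y₀, rfl⟩ : ∃ p y, z' = Sum.elim p y := ⟨_, _, (Sum.elim_comp_inl_inr z').symm⟩
  rw [map_mul, eval_rename, Sum.elim_comp_inl, map_mul, mul_ne_zero_iff, mul_ne_zero_iff] at hz'
  obtain ⟨hr0, hgp, hℓp⟩ := hz'
  have hpq := hℓ' p hℓp
  set r := sliceLeft p ρ with hr
  have hr0 : r ≠ 0 := fun h0 => hr0 (by rw [← eval_sliceLeft, ← hr, h0, map_zero])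
  obtain ⟨z, hz0, hz⟩ : ∃ z ≠ 0, ∀ y ≠ 0, eval (Sum.elim p y) G = 0 → eval (Sum.elim q y) G = 0 →
      crossProduct z y = 0 := by
    by_cases h : ∃ z ≠ 0, eval (Sum.elim p z) G = 0 ∧ eval (Sum.elim q z) G = 0
    · obtain ⟨z, hz, h1, h2⟩ := h
      refine ⟨z, hz, fun y hy h3 h4 => ?_⟩
      by_contra h5
      exact hgrid p q z y hgp hq.1 hpq h5 h1 h3 h2 h4
    · push Not at h
      exact ⟨q, hq0, fun y hy h1 h2 => absurd h2 (h y hy h1)⟩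
  have hzero : ∀ f ∈ UniqueFactorizationMonoid.factors r, ∃ y ≠ 0, eval y f = 0 := fun f hf => by
    have hirr := UniqueFactorizationMonoid.irreducible_of_factor f hf
    obtain ⟨y, hy, -, hy'⟩ := exists_eval_eq_zero_and_crossProduct_ne_zero (g := 1) hirr
      (fun h => hirr.not_isUnit (isUnit_of_dvd_one h)) {q} (by simpa using hq0)
    refine ⟨y, fun h => hy' q (by simp) (by simp [h]), hy⟩
  choose! η hη0 hη using hzero
  classical
  obtain ⟨x, hx⟩ := exists_eval_ne_zero_of_ne_zero (mul_ne_zero (mul_ne_zero hg (hGr0 z hz0))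
    (mul_ne_zero (Finset.prod_ne_zero_iff.2 fun f (hf : f ∈
      (UniqueFactorizationMonoid.factors r).toFinset) => hGr0 (η f) (hη0 f (by simpa using hf)))
      (linearForm_ne_zero hpq)))
  simp only [map_mul, map_prod, mul_ne_zero_iff, Finset.prod_ne_zero_iff, eval_sliceRight,
    eval_linearForm, Multiset.mem_toFinset] at hx
  obtain ⟨⟨hgx, hxz⟩, hxη, hxpq⟩ := hx
  have hf0 : sliceLeft x G ≠ 0 := fun h0 => hxz (by rw [← eval_sliceLeft, h0, map_zero])
  obtain ⟨E, hE, hEf, -⟩ := exists_irreducible_dvd_of_eval_eq_zero hf0 (z := 0) (by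
    have := hGy x 0 0
    rwa [smul_zero, zero_pow (by omega), zero_mul, ← eval_sliceLeft] at this)
  have hEG : ∀ y, eval y E = 0 → eval (Sum.elim x y) G = 0 := fun y hy => by
    obtain ⟨Q, hQ⟩ := hEf
    rw [← eval_sliceLeft, hQ, map_mul, hy, zero_mul]
  obtain ⟨e, he⟩ := (hGl x).exists_of_dvd hf0 hEf
  replace he : E.IsHomogeneous e := he
  have he0 : e ≠ 0 := by
    rintro rfl
    apply hE.not_isUnit
    have h1 := totalDegree_eq_zero_iff_eq_C.1 ((totalDegree_zero_iff_isHomogeneous _).2 he)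
    rw [h1]
    exact (isUnit_iff_ne_zero.2 fun h2 => hE.ne_zero (by rw [h1, h2, C_0])).map C
  have hEr : ¬ E ∣ r := fun h => by
    obtain ⟨f, hf, hass⟩ := UniqueFactorizationMonoid.exists_mem_factors_of_dvd hr0 hE h
    obtain ⟨Q, hQ⟩ := hass.symm.dvd
    refine hxη f hf (hEG _ ?_)
    rw [hQ, map_mul, hη f hf, zero_mul]
  obtain ⟨o, ho⟩ := exists_eval_ne_zero_of_ne_zero hE.ne_zero
  have ho0 : o ≠ 0 := by
    rintro rfl
    have := he.eval_smul_s7 0 0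
    rw [smul_zero, zero_pow he0, zero_mul] at this
    exact ho this
  obtain ⟨ρ₁, hρ₁, hρ₁'⟩ := exists_separable_restrictLine hE.squarefree o
  obtain ⟨ρ₂, hρ₂, hρ₂'⟩ := exists_isCoprime_restrictLine hE hEr o
  obtain ⟨ℓ', hℓ0, hℓw⟩ := exists_linearForm_forall_crossProduct_ne_zero ho0
  obtain ⟨w, hw⟩ := exists_eval_ne_zero_of_ne_zero hℓ0
  replace hw := hℓw w hw
  obtain ⟨u, hu⟩ := exists_eval_ne_zero_of_ne_zero
    (mul_ne_zero (mul_ne_zero hρ₁ hρ₂) (linearForm_ne_zero hw))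
  rw [map_mul, mul_ne_zero_iff, eval_linearForm] at hu
  obtain ⟨hu1, hu2⟩ := hu
  refine false_of_pencil (G := G) (a := a) (b := b) hGx hGy he
    (hb.trans (Nat.le_mul_of_pos_right b (Nat.pos_of_ne_zero he0))) (p := p) (q := q) (u := u)
    (w := w) (α := restrictLine (ρ₁ * ρ₂) u w) (β := restrictLine g p q)
    ho ?_ ?_ ?_ ?_ ?_ ?_ ?_ ?_
  · rintro y hy hEy ⟨h1, h2⟩
    obtain ⟨c, rfl⟩ := exists_smul_eq_of_crossProduct_eq_zero hz0 (hz y hy h1 h2)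
    have hc : c ≠ 0 := by
      rintro rfl
      simp at hy
    have := hEG _ hEy
    rw [hGy] at this
    exact mul_ne_zero (pow_ne_zero _ hc) hxz this
  · intro h0
    have := eval_restrictLine (ρ₁ * ρ₂) u w 0
    rw [h0] at this
    exact hu1 (by simpa using this.symm)
  · intro h0
    have := eval_restrictLine g p q 0
    rw [h0] at this
    exact hgp (by simpa using this.symm)
  · intro s hs
    rw [eval_restrictLine, map_mul, mul_ne_zero_iff] at hs
    refine ⟨hρ₁' _ hs.1, fun t ht => hρ' _ ?_⟩
    rw [← eval_sliceLeft, ← hr]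
    intro h0
    obtain ⟨A, B, hAB⟩ := hρ₂' _ hs.2
    have := congrArg (Polynomial.eval t) hAB
    simp [ht, h0] at this
  · rintro l hl y y' hy hy' hyy ⟨h1, h2⟩
    rw [eval_restrictLine] at hl
    refine hgrid x (p + l • q) y y' hgx hl (fun h => hxpq ?_) hyy (hEG y hy) (hEG y' hy') h1 h2
    have e0 := congrFun h 0
    have e1 := congrFun h 1
    have e2 := congrFun h 2
    simp only [cross_apply, Pi.add_apply, Pi.smul_apply, smul_eq_mul, Matrix.cons_val,
      Pi.zero_apply] at e0 e1 e2
    simp only [cross_apply, dotProduct, Fin.sum_univ_three, Matrix.cons_val]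
    linear_combination q 0 * e0 + q 1 * e1 + q 2 * e2
  · intro s t h0
    have := crossProduct_add_smul_add_smul_ne_zero hu2 (s := s) (t := t) (s' := s + 1) (t' := t)
      (by simp)
    rw [h0] at this
    simp at this
  · intro t h0
    apply hw
    rw [eq_neg_of_add_eq_zero_left h0]
    simp
  · intro s t s' t' h
    exact crossProduct_add_smul_add_smul_ne_zero hu2 h

end MvPolynomial

theorem exists_squarefree_dvd_dvd_pow {R : Type*} [CommRing R] [IsDomain R]
    [UniqueFactorizationMonoid R] {F : R} (hF : F ≠ 0) :
    ∃ G : R, Squarefree G ∧ G ∣ F ∧ ∃ n, F ∣ G ^ n := by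
  classical
  let _ : NormalizationMonoid R := Classical.choice inferInstance
  exact ⟨_, UniqueFactorizationMonoid.squarefree_radical,
    UniqueFactorizationMonoid.radical_dvd_self,
    UniqueFactorizationMonoid.exists_dvd_radical_self_pow hF⟩

theorem isHomogeneous_sliceRight {n : ℕ} {G : MvPolynomial (Fin n ⊕ Fin n) ℂ} {a : ℕ}
    (hG : G.IsWeightedHomogeneous (wx n) a) (y : Fin n → ℂ) : (sliceRight y G).IsHomogeneous a :=
  hG.isHomogeneous_aeval fun i => by
    rcases i with i | i
    · exact isHomogeneous_X _ _
    · exact isHomogeneous_C _ _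

theorem isHomogeneous_sliceLeft {n : ℕ} {G : MvPolynomial (Fin n ⊕ Fin n) ℂ} {b : ℕ}
    (hG : G.IsWeightedHomogeneous (wy n) b) (x : Fin n → ℂ) : (sliceLeft x G).IsHomogeneous b :=
  hG.isHomogeneous_aeval fun i => by
    rcases i with i | i
    · exact isHomogeneous_C _ _
    · exact isHomogeneous_X _ _

/-- If the zero set of `G`, restricted to `g ≠ 0` and to directions `y` off a finite set `V`,
contains no grid `{x, x'} × {y, y'}`, then it does not contain the whole plane over any `y₀`
off `V`. -/
theorem exists_eval_ne_zero_of_grid_free {G : MvPolynomial (Fin 3 ⊕ Fin 3) ℂ} {b : ℕ}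
    (hGl : ∀ x, (sliceLeft x G).IsHomogeneous b) (hb : b ≠ 0) {g : MvPolynomial (Fin 3) ℂ}
    (hg : g ≠ 0) {V : Finset (Fin 3 → ℂ)} (hV : ∀ v ∈ V, v ≠ 0)
    (hgrid : ∀ x x' y y', eval x g ≠ 0 → eval x' g ≠ 0 → crossProduct x' x ≠ 0 →
      crossProduct y y' ≠ 0 → (∀ v ∈ V, crossProduct y v ≠ 0 ∧ crossProduct y' v ≠ 0) →
      eval (Sum.elim x y) G = 0 → eval (Sum.elim x y') G = 0 →
      eval (Sum.elim x' y) G = 0 → eval (Sum.elim x' y') G ≠ 0)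
    {y₀ : Fin 3 → ℂ} (hy₀ : y₀ ≠ 0) (hy₀V : ∀ v ∈ V, crossProduct y₀ v ≠ 0) :
    ∃ x, eval (Sum.elim x y₀) G ≠ 0 := by
  classical
  by_contra! h
  obtain ⟨x₁, hx₁⟩ := exists_eval_ne_zero_of_ne_zero (mul_ne_zero hg (X_ne_zero (0 : Fin 3)))
  rw [map_mul, eval_X, mul_ne_zero_iff] at hx₁
  have hx₁0 : x₁ ≠ 0 := fun h0 => hx₁.2 (by simp [h0])
  obtain ⟨A, hA, hAf⟩ : ∃ A, Irreducible A ∧ A ∣ sliceLeft x₁ G := by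
    by_cases hf : sliceLeft x₁ G = 0
    · exact ⟨X 0, X_prime.irreducible, hf ▸ dvd_zero _⟩
    · obtain ⟨A, hA, hAf, -⟩ := exists_irreducible_dvd_of_eval_eq_zero hf (z := 0) (by
        simpa [zero_pow hb] using (hGl x₁).eval_smul_s7 0 0)
      exact ⟨A, hA, hAf⟩
  obtain ⟨y₁, hy₁, -, hy₁V⟩ := exists_eval_eq_zero_and_crossProduct_ne_zero (g := 1) hA
    (fun h => hA.not_isUnit (isUnit_of_dvd_one h)) (insert y₀ V)
      ((Finset.forall_mem_insert _ _ _).2 ⟨hy₀, hV⟩)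
  rw [Finset.forall_mem_insert] at hy₁V
  have h11 : eval (Sum.elim x₁ y₁) G = 0 := by
    obtain ⟨Q, hQ⟩ := hAf
    rw [← eval_sliceLeft, hQ, map_mul, hy₁, zero_mul]
  obtain ⟨x₂, hx₂, hx₂g, hx₂1⟩ : ∃ x₂, eval (Sum.elim x₂ y₁) G = 0 ∧ eval x₂ g ≠ 0 ∧
      crossProduct x₂ x₁ ≠ 0 := by
    by_cases hf : sliceRight y₁ G = 0
    · obtain ⟨ℓ, hℓ, hℓ'⟩ := exists_linearForm_forall_crossProduct_ne_zero hx₁0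
      obtain ⟨x₂, hx₂⟩ := exists_eval_ne_zero_of_ne_zero (mul_ne_zero hg hℓ)
      rw [map_mul, mul_ne_zero_iff] at hx₂
      exact ⟨x₂, by rw [← eval_sliceRight, hf, map_zero], hx₂.1, hℓ' _ hx₂.2⟩
    · obtain ⟨B, hB, ⟨Q, hQ⟩, hB1⟩ := exists_irreducible_dvd_of_eval_eq_zero hf (z := x₁)
        (by rwa [eval_sliceRight])
      obtain ⟨x₂, hx₂, hx₂g, hx₂1⟩ := exists_eval_eq_zero_and_crossProduct_ne_zero (g := g) hB
        (fun ⟨P, hP⟩ => hx₁.1 (by rw [hP, map_mul, hB1, zero_mul])) {x₁} (by simpa using hx₁0)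
      exact ⟨x₂, by rw [← eval_sliceRight, hQ, map_mul, hx₂, zero_mul], hx₂g, hx₂1 _ (by simp)⟩
  exact hgrid x₁ x₂ y₁ y₀ hx₁.1 hx₂g hx₂1 hy₁V.1 (fun v hv => ⟨hy₁V.2 v hv, hy₀V v hv⟩) h11
    (h _) hx₂ (h _)

theorem Projectivization.mk_ne_mk_of_crossProduct_ne_zero {x y : Fin 3 → ℂ} (hx : x ≠ 0)
    (hy : y ≠ 0) (h : crossProduct x y ≠ 0) :
    Projectivization.mk ℂ x hx ≠ Projectivization.mk ℂ y hy := by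
  rw [Ne, Projectivization.mk_eq_mk_iff']
  rintro ⟨c, rfl⟩
  exact h (by simp)

/-- Proposition 4.5 of the paper.  Let `H = {F = 0} ⊆ ℙ² × ℙ²` for a
nonzero bihomogeneous `F`, let `X ⊆ ℙ²` be nonempty Zariski-open, and let
`Y = ℙ² \ {v₁,…,v_n}`.  If `H ∩ (X × Y)` is `(2,2)`-grid-free, then either there is a
bihomogeneous `F'` of degree `≤ 2` in the `y`-variables with
`H ∩ (X × Y) = {F' = 0} ∩ (X × Y)`, or `ℙ² × {vᵢ} ⊆ H` for some `i`. -/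
theorem stmt7
    (F : MvPolynomial (Fin 3 ⊕ Fin 3) ℂ) (hF0 : F ≠ 0) (hFbh : Bihom F)
    (X : Set (Pt 3)) (hX : ZarOpen X) (hXne : X.Nonempty)
    (n : ℕ) (v : Fin n → Pt 3)
    (Y : Set (Pt 3)) (hY : Y = {q : Pt 3 | ∀ i, q ≠ v i})
    (hgf : GridFree 2 2 (zeroSet F ∩ X ×ˢ Y)) :
    (∃ F' : MvPolynomial (Fin 3 ⊕ Fin 3) ℂ, Bihom F' ∧ ydeg F' ≤ 2 ∧
        zeroSet F ∩ X ×ˢ Y = zeroSet F' ∩ X ×ˢ Y) ∨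
      (∃ i, ∀ p : Pt 3, (p, v i) ∈ zeroSet F) := by
  classical
  obtain ⟨a', b', hFx, hFy⟩ := hFbh
  obtain ⟨G, hGsf, hGF, m, hFG⟩ := exists_squarefree_dvd_dvd_pow hF0
  obtain ⟨a, hGx⟩ := hFx.exists_of_dvd hF0 hGF
  obtain ⟨b, hGy⟩ := hFy.exists_of_dvd hF0 hGF
  have hzero : ∀ z, eval z F = 0 ↔ eval z G = 0 := fun z => by
    refine ⟨fun h => ?_, fun h => ?_⟩
    · obtain ⟨Q, hQ⟩ := hFG
      have := congrArg (eval z) hQ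
      rw [map_mul, h, zero_mul, map_pow] at this
      exact eq_zero_of_pow_eq_zero this
    · obtain ⟨Q, rfl⟩ := hGF
      rw [map_mul, h, zero_mul]
  by_cases hb : b ≤ 2
  · refine Or.inl ⟨G, ⟨a, b, hGx, hGy⟩, ?_, ?_⟩
    · exact Finset.sup_le fun _ hd => (hGy (mem_support_iff.1 hd)).le.trans hb
    · congr 1
      ext p
      exact hzero _
  refine Or.inr ?_
  by_contra! hno
  have hGr := isHomogeneous_sliceRight hGx
  have hGl := isHomogeneous_sliceLeft hGy
  obtain ⟨S, hS, hXS⟩ := hX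
  obtain ⟨x₀, hx₀⟩ := hXne
  rw [hXS, Set.mem_ofPred_eq] at hx₀
  push Not at hx₀
  obtain ⟨g, hgS, hgx⟩ := hx₀
  obtain ⟨d, hd⟩ := hS g hgS
  have hg0 : g ≠ 0 := fun h => hgx (by rw [h, map_zero])
  have hmemX : ∀ x (hx : x ≠ 0), eval x g ≠ 0 → Projectivization.mk ℂ x hx ∈ X := by
    intro x hx hxg
    rw [hXS, Set.mem_ofPred_eq]
    obtain ⟨c, hc⟩ := Projectivization.exists_smul_eq_mk_rep ℂ x hx
    intro h
    have := h g hgS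
    rw [← hc, Units.smul_def, hd.eval_smul_s7] at this
    exact mul_ne_zero (pow_ne_zero _ c.ne_zero) hxg this
  have hmemF : ∀ x y (hx : x ≠ 0) (hy : y ≠ 0), eval (Sum.elim x y) G = 0 →
      (Projectivization.mk ℂ x hx, Projectivization.mk ℂ y hy) ∈ zeroSet F := by
    intro x y hx hy h
    obtain ⟨c, hc⟩ := Projectivization.exists_smul_eq_mk_rep ℂ x hx
    obtain ⟨c', hc'⟩ := Projectivization.exists_smul_eq_mk_rep ℂ y hy
    rw [zeroSet, Set.mem_ofPred_eq, hzero, ← hc, ← hc', Units.smul_def, Units.smul_def,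
      ← eval_sliceLeft, (hGl _).eval_smul_s7, eval_sliceLeft, ← eval_sliceRight, (hGr _).eval_smul_s7,
      eval_sliceRight, h, mul_zero, mul_zero]
  have hrep : ∀ x y i, y ≠ 0 → crossProduct y (v i).rep = 0 → eval (Sum.elim x y) G = 0 →
      eval (Sum.elim x (v i).rep) G = 0 := by
    intro x y i hy hyv h
    obtain ⟨c, hc⟩ := exists_smul_eq_of_crossProduct_eq_zero hy hyv
    rw [← hc, ← eval_sliceLeft, (hGl _).eval_smul_s7, eval_sliceLeft, h, mul_zero]
  have hgrid : ∀ x x' y y', eval x g ≠ 0 → eval x' g ≠ 0 → crossProduct x' x ≠ 0 →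
      crossProduct y y' ≠ 0 → (∀ i, crossProduct y (v i).rep ≠ 0 ∧ crossProduct y' (v i).rep ≠ 0) →
      eval (Sum.elim x y) G = 0 → eval (Sum.elim x y') G = 0 →
      eval (Sum.elim x' y) G = 0 → eval (Sum.elim x' y') G ≠ 0 := by
    intro x x' y y' hxg hxg' hxx hyy hv h1 h2 h3 h4
    have hx : x ≠ 0 := fun h => hxx (by simp [h])
    have hx' : x' ≠ 0 := fun h => hxx (by simp [h])
    have hy : y ≠ 0 := fun h => hyy (by simp [h])
    have hy' : y' ≠ 0 := fun h => hyy (by simp [h])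
    have hmemY : ∀ y (hy : y ≠ 0), (∀ i, crossProduct y (v i).rep ≠ 0) →
        Projectivization.mk ℂ y hy ∈ Y := by
      intro y hy hyv
      rw [hY, Set.mem_ofPred_eq]
      intro i hi
      rw [← (v i).mk_rep] at hi
      exact Projectivization.mk_ne_mk_of_crossProduct_ne_zero hy (v i).rep_nonzero (hyv i) hi
    refine hgf ⟨{Projectivization.mk ℂ x' hx', Projectivization.mk ℂ x hx},
      {Projectivization.mk ℂ y hy, Projectivization.mk ℂ y' hy'},
      Finset.card_pair (Projectivization.mk_ne_mk_of_crossProduct_ne_zero hx' hx hxx),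
      Finset.card_pair (Projectivization.mk_ne_mk_of_crossProduct_ne_zero hy hy' hyy), ?_⟩
    have hm := hmemX x hx hxg
    have hm' := hmemX x' hx' hxg'
    have hn := hmemY y hy fun i => (hv i).1
    have hn' := hmemY y' hy' fun i => (hv i).2
    simp only [Finset.forall_mem_insert, Finset.mem_singleton, forall_eq]
    exact ⟨⟨⟨hmemF _ _ _ _ h3, hm', hn⟩, ⟨hmemF _ _ _ _ h4, hm', hn'⟩⟩,
      ⟨hmemF _ _ _ _ h1, hm, hn⟩, ⟨hmemF _ _ _ _ h2, hm, hn'⟩⟩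
  have hbase : ∀ y ≠ 0, ∃ x, eval (Sum.elim x y) G ≠ 0 := by
    intro y hy
    by_cases hyv : ∃ i, crossProduct y (v i).rep = 0
    · obtain ⟨i, hi⟩ := hyv
      obtain ⟨p, hp⟩ := hno i
      rw [zeroSet, Set.mem_ofPred_eq, hzero] at hp
      exact ⟨p.rep, fun h => hp (hrep _ _ _ hy hi h)⟩
    · push Not at hyv
      refine exists_eval_ne_zero_of_grid_free hGl (by omega) hg0
        (V := Finset.univ.image fun i => (v i).rep) ?_ ?_ hy ?_
      · simpa using fun i => (v i).rep_nonzero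
      · intro x x' y y' h1 h2 h3 h4 h5
        exact hgrid x x' y y' h1 h2 h3 h4 (by simpa using h5)
      · simpa using hyv
  have hslice : ∀ i, sliceRight (v i).rep G ≠ 0 := fun i h0 => by
    obtain ⟨x, hx⟩ := hbase _ (v i).rep_nonzero
    exact hx (by rw [← eval_sliceRight, h0, map_zero])
  refine false_of_squarefree hGsf hGr hGl (by omega)
    (mul_ne_zero hg0 (Finset.prod_ne_zero_iff.2 fun i (_ : i ∈ Finset.univ) => hslice i)) ?_ hbase
  intro x x' y y' hx hx' hxx hyy h1 h2 h3
  simp only [map_mul, map_prod, mul_ne_zero_iff, Finset.prod_ne_zero_iff, Finset.mem_univ,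
    true_imp_iff, eval_sliceRight] at hx hx'
  refine hgrid x x' y y' hx.1 hx'.1 (fun h => hxx ?_) hyy (fun i => ⟨fun h => ?_, fun h => ?_⟩)
    h1 h2 h3
  · rw [← cross_anticomm, h, neg_zero]
  · exact hx.2 i (hrep _ _ _ (fun h => hyy (by simp [h])) h h1)
  · exact hx.2 i (hrep _ _ _ (fun h => hyy (by simp [h])) h h2)
end
end

section
/- Let s, t ≥ 1 and let V₁ ⊆ ℙˢ × ℙˢ be almost-(s,t)-grid-free. Let U_X, U_X', U_Y, U_Y' be nonempty Zariski-open subsets of ℙˢ, and let σ_X : U_X → U_X' and σ_Y : U_Y → U_Y' be bijections with the property that for every nonempty Zariski-open W ⊆ ℙˢ, the image σ_X(W ∩ U_X) contains a set of the form W' ∩ U_X' for some nonempty Zariski-open W' ⊆ ℙˢ, and likewise for σ_Y. Then the set V₂ := {(σ_X(u), σ_Y(v)) : (u,v) ∈ V₁ ∩ (U_X × U_Y)} is almost-(s,t)-grid-free. -/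
open MvPolynomial

noncomputable section

/-- `V ⊆ ℙˢ × ℙˢ` is almost-`(s,t)`-grid-free if there are nonempty Zariski-open
`X, Y ⊆ ℙˢ` such that `V ∩ (X × Y)` is `(s,t)`-grid-free. -/
def AlmostGridFree {n : ℕ} (s t : ℕ) (V : Set (Pt n × Pt n)) : Prop :=
  ∃ X Y : Set (Pt n), ZarOpen X ∧ X.Nonempty ∧ ZarOpen Y ∧ Y.Nonempty ∧
    GridFree s t (V ∩ X ×ˢ Y)

/-- A finite set covered by the image of `A` lifts to a subset of `A` of the same cardinality. -/
theorem Finset.exists_card_eq_of_subset_image {α β : Type*} {f : α → β} {A : Set α}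
    (S : Finset β) (hS : (S : Set β) ⊆ f '' A) :
    ∃ S' : Finset α, S'.card = S.card ∧ (S' : Set α) ⊆ A ∧ ∀ u ∈ S', f u ∈ S := by
  obtain ⟨S', hS'A, hbij⟩ := Set.SurjOn.exists_bijOn_subset hS
  have hfin : S'.Finite := hbij.finite_iff_finite.mpr S.finite_toSet
  refine ⟨hfin.toFinset, ?_, by simpa using hS'A, ?_⟩
  · rw [← Set.ncard_eq_toFinset_card S' hfin, ← Set.ncard_coe_finset S, ← hbij.image_eq,
      hbij.injOn.ncard_image]
  · intro u hu
    exact hbij.mapsTo (hfin.mem_toFinset.mp hu)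

/-- Proposition 2.3 of the paper, set-theoretic form: almost-`(s,t)`-grid-
freeness is invariant under applying birational automorphisms (encoded as bijections between
nonempty Zariski-open subsets with Zariski-dense-image behaviour) to each coordinate. -/
theorem stmt8
    (s t : ℕ) (hs : 1 ≤ s) (ht : 1 ≤ t)
    (V₁ : Set (Pt (s + 1) × Pt (s + 1))) (hV₁ : AlmostGridFree s t V₁)
    (UX UX' UY UY' : Set (Pt (s + 1)))
    (hUX : ZarOpen UX) (hUXne : UX.Nonempty)
    (hUX' : ZarOpen UX') (hUX'ne : UX'.Nonempty)
    (hUY : ZarOpen UY) (hUYne : UY.Nonempty)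
    (hUY' : ZarOpen UY') (hUY'ne : UY'.Nonempty)
    (σX σY : Pt (s + 1) → Pt (s + 1))
    (hσX : Set.BijOn σX UX UX') (hσY : Set.BijOn σY UY UY')
    (hdX : ∀ W : Set (Pt (s + 1)), ZarOpen W → W.Nonempty →
      ∃ W' : Set (Pt (s + 1)), ZarOpen W' ∧ W'.Nonempty ∧ W' ∩ UX' ⊆ σX '' (W ∩ UX))
    (hdY : ∀ W : Set (Pt (s + 1)), ZarOpen W → W.Nonempty →
      ∃ W' : Set (Pt (s + 1)), ZarOpen W' ∧ W'.Nonempty ∧ W' ∩ UY' ⊆ σY '' (W ∩ UY)) :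
    AlmostGridFree s t
      {p : Pt (s + 1) × Pt (s + 1) |
        ∃ u v, (u, v) ∈ V₁ ∩ UX ×ˢ UY ∧ p = (σX u, σY v)} := by
  obtain ⟨X, Y, hX, hXne, hY, hYne, hfree⟩ := hV₁
  obtain ⟨X', hX', hX'ne, hsubX⟩ := hdX X hX hXne
  obtain ⟨Y', hY', hY'ne, hsubY⟩ := hdY Y hY hYne
  refine ⟨X', Y', hX', hX'ne, hY', hY'ne, ?_⟩
  rintro ⟨S, T, hSs, hTt, hST⟩
  obtain ⟨a₀, ha₀⟩ : S.Nonempty := Finset.card_pos.mp (by omega)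
  obtain ⟨b₀, hb₀⟩ : T.Nonempty := Finset.card_pos.mp (by omega)
  have hSX : (S : Set (Pt (s + 1))) ⊆ σX '' (X ∩ UX) := by
    intro a ha
    obtain ⟨⟨u, v, huv, heq⟩, hmem⟩ := hST a ha b₀ hb₀
    obtain ⟨rfl, -⟩ := Prod.mk.inj heq
    exact hsubX ⟨hmem.1, hσX.mapsTo huv.2.1⟩
  have hTY : (T : Set (Pt (s + 1))) ⊆ σY '' (Y ∩ UY) := by
    intro b hb
    obtain ⟨⟨u, v, huv, heq⟩, hmem⟩ := hST a₀ ha₀ b hb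
    obtain ⟨-, rfl⟩ := Prod.mk.inj heq
    exact hsubY ⟨hmem.2, hσY.mapsTo huv.2.2⟩
  obtain ⟨S', hS'card, hS'X, hS'⟩ := S.exists_card_eq_of_subset_image hSX
  obtain ⟨T', hT'card, hT'Y, hT'⟩ := T.exists_card_eq_of_subset_image hTY
  refine hfree ⟨S', T', hS'card.trans hSs, hT'card.trans hTt, fun u hu v hv => ?_⟩
  obtain ⟨⟨u', v', huv, heq⟩, -⟩ := hST _ (hS' u hu) _ (hT' v hv)
  obtain ⟨hequ, heqv⟩ := Prod.mk.inj heq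
  obtain rfl := hσX.injOn (hS'X hu).2 huv.2.1 hequ
  obtain rfl := hσY.injOn (hT'Y hv).2 huv.2.2 heqv
  exact ⟨huv.1, (hS'X hu).1, (hT'Y hv).1⟩
end
end

section
/- Let T := {v ∈ ℙ² : v₀v₁v₂ ≠ 0} be the set of points of ℙ² all of whose coordinates are nonzero. Then the set H₂ ∩ (ℙ² × T), where H₂ := {(u,v) ∈ ℙ² × ℙ² : u₀v₁v₂ + u₁v₀v₂ + u₂v₀v₁ = 0}, is (2,2)-grid-free: there do not exist u, u' ∈ ℙ² with u ≠ u' and v, v' ∈ T with v ≠ v' such that u₀v₁v₂ + u₁v₀v₂ + u₂v₀v₁ = 0 holds for all four pairs (u,v), (u,v'), (u',v), (u',v'). -/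
noncomputable section

/-- Points of the complex projective plane `ℙ²`: nonzero vectors of `ℂ³` up to scalar. -/
abbrev P2 := Projectivization ℂ (Fin 3 → ℂ)

/-- The form `u₀v₁v₂ + u₁v₀v₂ + u₂v₀v₁` of Example 2.2 of the paper, evaluated on
representatives; its vanishing is independent of the chosen representatives. -/
def Q (u v : P2) : ℂ :=
  u.rep 0 * v.rep 1 * v.rep 2 + u.rep 1 * v.rep 0 * v.rep 2 + u.rep 2 * v.rep 0 * v.rep 1

/-- The torus `T ⊆ ℙ²` of points with all coordinates nonzero. -/
def torus : Set P2 := {v : P2 | v.rep 0 * v.rep 1 * v.rep 2 ≠ 0}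

/-- The pairwise products of the coordinates of a vector in `F³`, i.e. the standard Cremona
transformation of the plane in homogeneous coordinates. -/
def cremona {F : Type*} [CommRing F] (v : Fin 3 → F) : Fin 3 → F :=
  ![v 1 * v 2, v 0 * v 2, v 0 * v 1]

theorem crossProduct_eq_zero_of_cremona {F : Type*} [CommRing F] [IsDomain F] {v w : Fin 3 → F}
    (hv : v 0 * v 1 * v 2 ≠ 0) (hw : w 0 * w 1 * w 2 ≠ 0)
    (h : crossProduct (cremona v) (cremona w) = 0) : crossProduct v w = 0 := by
  simp only [ne_eq, mul_eq_zero, not_or] at hv hw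
  obtain ⟨⟨hv₀, hv₁⟩, hv₂⟩ := hv
  obtain ⟨⟨hw₀, hw₁⟩, hw₂⟩ := hw
  have h₀ := congrFun h 0
  have h₁ := congrFun h 1
  have h₂ := congrFun h 2
  simp only [cross_apply, cremona, Matrix.cons_val, Pi.zero_apply] at h₀ h₁ h₂
  ext i
  fin_cases i <;> simp only [cross_apply, Matrix.cons_val, Pi.zero_apply, Fin.zero_eta,
    Fin.mk_one, Fin.reduceFinMk]
  · exact mul_left_cancel₀ (mul_ne_zero hv₀ hw₀) (by linear_combination -h₀)
  · exact mul_left_cancel₀ (mul_ne_zero hv₁ hw₁) (by linear_combination -h₁)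
  · exact mul_left_cancel₀ (mul_ne_zero hv₂ hw₂) (by linear_combination -h₂)

theorem Q_eq_dotProduct_cremona (u v : P2) : Q u v = dotProduct u.rep (cremona v.rep) := by
  simp only [Q, cremona, dotProduct, Fin.sum_univ_three, Matrix.cons_val]
  ring

theorem P2.eq_of_crossProduct_rep_eq_zero {u v : P2} (h : crossProduct u.rep v.rep = 0) :
    u = v := by
  rw [← u.mk_rep, ← v.mk_rep]
  exact (Projectivization.mk_eq_mk_iff_crossProduct_eq_zero _ _).mpr h

theorem eq_or_eq_of_Q_eq_zero {u u' v v' : P2} (hv : v ∈ torus) (hv' : v' ∈ torus)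
    (huv : Q u v = 0) (huv' : Q u v' = 0) (hu'v : Q u' v = 0) (hu'v' : Q u' v' = 0) :
    u = u' ∨ v = v' := by
  rw [Q_eq_dotProduct_cremona] at huv huv' hu'v hu'v'
  exact (Configuration.ofField.crossProduct_eq_zero_of_dotProduct_eq_zero huv hu'v huv' hu'v').imp
    P2.eq_of_crossProduct_rep_eq_zero
    fun h ↦ P2.eq_of_crossProduct_rep_eq_zero (crossProduct_eq_zero_of_cremona hv hv' h)

/-- Example 2.2 of the paper.  The set `H₂ ∩ (ℙ² × T)`, where
`H₂ = {u₀v₁v₂ + u₁v₀v₂ + u₂v₀v₁ = 0}`, is `(2,2)`-grid-free: there are no `u ≠ u'` in `ℙ²`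
and `v ≠ v'` in `T` with `Q` vanishing on all four combinations. -/
theorem stmt11 :
    GridFree 2 2 ({p : P2 × P2 | Q p.1 p.2 = 0} ∩ (Set.univ ×ˢ torus)) ∧
      ¬ ∃ (u u' v v' : P2), u ≠ u' ∧ v ≠ v' ∧ v ∈ torus ∧ v' ∈ torus ∧
        Q u v = 0 ∧ Q u v' = 0 ∧ Q u' v = 0 ∧ Q u' v' = 0 := by
  constructor
  · rintro ⟨S, T, hS, hT, h⟩
    obtain ⟨u, hu, u', hu', hne⟩ := Finset.one_lt_card.mp (by omega : 1 < S.card)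
    obtain ⟨v, hv, v', hv', hne'⟩ := Finset.one_lt_card.mp (by omega : 1 < T.card)
    exact (eq_or_eq_of_Q_eq_zero (h u hu v hv).2.2 (h u hu v' hv').2.2 (h u hu v hv).1
      (h u hu v' hv').1 (h u' hu' v hv).1 (h u' hu' v' hv').1).elim hne hne'
  · rintro ⟨u, u', v, v', hne, hne', hv, hv', huv, huv', hu'v, hu'v'⟩
    exact (eq_or_eq_of_Q_eq_zero hv hv' huv huv' hu'v hu'v').elim hne hne'
end
end

section
/- Let P₁, Q₁, P₂, Q₂ be nonzero polynomials in the polynomial ring ℂ[y₀,y₁,y₂] such that P₁ and Q₁ have no common nonconstant factor and P₂ and Q₂ have no common nonconstant factor, and let d ≥ 1 be an integer. Then every common divisor of Q₁^{d−1}·Q₂ and Q₁^d·P₂ + P₁^d·Q₂ divides Q₂². -/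
noncomputable section

/-- In a cancellative decomposition monoid, a common divisor of `a * c` and `b * c` divides `c`
when `a` and `b` are relatively prime. -/
theorem IsRelPrime.dvd_of_dvd_mul_of_dvd_mul {α : Type*} [CommMonoidWithZero α]
    [IsCancelMulZero α] [DecompositionMonoid α] {a b c g : α} (hab : IsRelPrime a b)
    (ha : g ∣ a * c) (hb : g ∣ b * c) : g ∣ c := by
  obtain ⟨x, y, hx, ⟨z, rfl⟩, rfl⟩ := exists_dvd_and_dvd_of_dvd_mul ha
  rcases eq_or_ne y 0 with rfl | hy
  · simp
  have hxz : x ∣ b * z := by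
    rw [mul_left_comm, mul_comm x y] at hb
    exact (mul_dvd_mul_iff_left hy).mp hb
  rw [mul_comm x y]
  exact mul_dvd_mul_left y ((hab.of_dvd_left hx).dvd_of_dvd_mul_left hxz)

/-- Over a field, two polynomials whose common divisors all have degree zero are relatively
prime, provided the first one is nonzero. -/
theorem MvPolynomial.isRelPrime_of_totalDegree_eq_zero {σ K : Type*} [Field K]
    {p q : MvPolynomial σ K} (hp : p ≠ 0)
    (h : ∀ r : MvPolynomial σ K, r ∣ p → r ∣ q → r.totalDegree = 0) : IsRelPrime p q := by
  intro r hrp hrq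
  have hr : r = C (r.coeff 0) := totalDegree_eq_zero_iff_eq_C.mp (h r hrp hrq)
  have hr₀ : r.coeff 0 ≠ 0 := fun h₀ ↦
    ne_zero_of_dvd_ne_zero hp hrp (by rw [hr, h₀, C_0])
  rw [hr]
  exact (isUnit_iff_ne_zero.mpr hr₀).map C

/-- the computation in Remark 2.4 of the paper.  If `P₁, Q₁` have no
common nonconstant factor and `P₂, Q₂` have no common nonconstant factor in `ℂ[y₀,y₁,y₂]`,
all four being nonzero, and `d ≥ 1`, then every common divisor of `Q₁^{d-1}·Q₂` and
`Q₁^d·P₂ + P₁^d·Q₂` divides `Q₂²`. -/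
theorem stmt12
    (P₁ Q₁ P₂ Q₂ : MvPolynomial (Fin 3) ℂ)
    (hP₁ : P₁ ≠ 0) (hQ₁ : Q₁ ≠ 0) (hP₂ : P₂ ≠ 0) (hQ₂ : Q₂ ≠ 0)
    (h₁ : ∀ r : MvPolynomial (Fin 3) ℂ, r ∣ P₁ → r ∣ Q₁ → r.totalDegree = 0)
    (h₂ : ∀ r : MvPolynomial (Fin 3) ℂ, r ∣ P₂ → r ∣ Q₂ → r.totalDegree = 0)
    (d : ℕ) (hd : 1 ≤ d) :
    ∀ G : MvPolynomial (Fin 3) ℂ,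
      G ∣ Q₁ ^ (d - 1) * Q₂ → G ∣ Q₁ ^ d * P₂ + P₁ ^ d * Q₂ → G ∣ Q₂ ^ 2 := by
  intro G hG₁ hG₂
  have hrel : IsRelPrime (P₁ ^ d) (Q₁ ^ d) :=
    (MvPolynomial.isRelPrime_of_totalDegree_eq_zero hP₁ h₁).pow
  have hQ : G ∣ Q₁ ^ d * Q₂ :=
    hG₁.trans (mul_dvd_mul_right (pow_dvd_pow Q₁ (Nat.sub_le d 1)) Q₂)
  have hP : G ∣ P₁ ^ d * Q₂ ^ 2 := by
    have h := dvd_sub (hG₂.mul_right Q₂) (hQ.mul_right P₂)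
    convert h using 1
    ring
  refine hrel.dvd_of_dvd_mul_of_dvd_mul hP ?_
  rw [pow_two, ← mul_assoc]
  exact hQ.mul_right Q₂
end
end
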